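/- Let B be an approximable integral graded K-algebra equipped with ℝ-filtrations on each B_n making B f-quasi-filtered for some f: ℕ → ℝ₊ with f(n)/n → 0, and assume sup_{n≥1} λ_max(B_n)/n < +∞. Then the sequence of probability measures (T_{1/n} ν_{B_n})_{n≥1} converges vaguely to a Borel probability measure on ℝ. -/

import Mathlib

open Module MeasureTheory Set Filter

/-- Laurent monomials in algebraically independent elements are linearly independent. -/
lemma AlgebraicIndependent.linearIndependent_zpow {K E : Type*} [Field K] [Field E] [Algebra K E]
    {d : ℕ} {y : Fin d → E} (hy : AlgebraicIndependent K y) :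
    LinearIndependent K (fun a : Fin d → ℤ => ∏ i, y i ^ a i) := by
  classical
  have hy0 : ∀ i, y i ≠ 0 := fun i => hy.ne_zero i
  rw [linearIndependent_iff']
  intro s g hg a ha
  obtain ⟨b, hb⟩ : ∃ b : Fin d → ℤ, ∀ a ∈ s, ∀ i, 0 ≤ a i + b i := by
    refine ⟨fun i => ∑ a ∈ s, |a i|, fun a ha i => ?_⟩
    have := Finset.single_le_sum (f := fun a : Fin d → ℤ => |a i|)
      (fun _ _ => abs_nonneg _) ha
    have := neg_abs_le (a i)
    simp only at *
    linarith
  let e : (Fin d → ℤ) → (Fin d →₀ ℕ) := fun a => Finsupp.equivFunOnFinite.symm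
    fun i => (a i + b i).toNat
  have he : ∀ a ∈ s, ∀ a' ∈ s, e a = e a' → a = a' := by
    intro a ha a' ha' h
    ext i
    have h1 := DFunLike.congr_fun h i
    simp only [e, Finsupp.equivFunOnFinite_symm_apply_apply] at h1
    have := hb a ha i
    have := hb a' ha' i
    omega
  let p : MvPolynomial (Fin d) K := ∑ a ∈ s, MvPolynomial.monomial (e a) (g a)
  have hp : MvPolynomial.aeval y p = 0 := by
    have : MvPolynomial.aeval y p
        = (∑ a ∈ s, g a • ∏ i, y i ^ a i) * ∏ i, y i ^ b i := by
      simp only [p, map_sum, Finset.sum_mul]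
      refine Finset.sum_congr rfl fun a ha => ?_
      rw [MvPolynomial.aeval_monomial, Algebra.smul_def, mul_assoc, ← Finset.prod_mul_distrib]
      congr 1
      rw [Finsupp.prod_fintype _ _ (by simp)]
      refine Finset.prod_congr rfl fun i _ => ?_
      rw [← zpow_add₀ (hy0 i), ← zpow_natCast]
      congr 1
      simp [e, Int.toNat_of_nonneg (hb a ha i)]
    rw [this, hg, zero_mul]
  have hp0 : p = 0 := (injective_iff_map_eq_zero _).1 hy _ hp
  have := congrArg (MvPolynomial.coeff (e a)) hp0
  simp only [p, MvPolynomial.coeff_sum, MvPolynomial.coeff_monomial, MvPolynomial.coeff_zero] at this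
  rwa [Finset.sum_eq_single a, if_pos rfl] at this
  · intro a' ha' hne
    rw [if_neg fun h => hne (he _ ha' _ ha h)]
  · exact fun h => absurd ha h

/-- Algebraically independent elements can be given multiplicatively independent values by a
valuation trivial on the ground field. -/
lemma AlgebraicIndependent.exists_valuationSubring {K E : Type*} [Field K] [Field E] [Algebra K E]
    {d : ℕ} {y : Fin d → E} (hy : AlgebraicIndependent K y) :
    ∃ O : ValuationSubring E, (∀ c : K, c ≠ 0 → O.valuation (algebraMap K E c) = 1) ∧
      ∀ a : Fin d → ℤ, O.valuation (∏ i, y i ^ a i) = 1 → a = 0 := by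
  have hy0 : ∀ i, y i ≠ 0 := fun i => hy.ne_zero i
  let mono : (Fin d → ℤ) → E := fun a => ∏ i, y i ^ a i
  have hadd : ∀ a b, mono (a + b) = mono a * mono b := fun a b => by
    simp only [mono, ← Finset.prod_mul_distrib, Pi.add_apply]
    exact Finset.prod_congr rfl fun i _ => zpow_add₀ (hy0 i) _ _
  let P : Set (Fin d → ℤ) := {a | 0 < toLex a}
  let M : Submodule K E := Submodule.span K (mono '' P)
  have h1 : (1 : E) ∉ M := by
    have := hy.linearIndependent_zpow.notMem_span_image (s := P) (x := 0)
      (fun h => lt_irrefl (0 : Lex (Fin d → ℤ)) h)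
    simpa [M, mono] using this
  have hMM : ∀ x ∈ M, ∀ y ∈ M, x * y ∈ M := by
    have : M * M ≤ M := by
      simp only [M, Submodule.span_mul_span]
      refine Submodule.span_mono ?_
      rintro _ ⟨_, ⟨a, ha, rfl⟩, _, ⟨b, hb, rfl⟩, rfl⟩
      exact ⟨a + b, add_pos (α := Lex (Fin d → ℤ)) ha hb, hadd a b⟩
    exact fun x hx y hy => this (Submodule.mul_mem_mul hx hy)
  let A : Subring E :=
    { carrier := {x | ∃ c : K, x - algebraMap K E c ∈ M}
      mul_mem' := by
        rintro x z ⟨c, hc⟩ ⟨c', hc'⟩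
        refine ⟨c * c', ?_⟩
        have : x * z - algebraMap K E (c * c') =
            (x - algebraMap K E c) * (z - algebraMap K E c') +
            c' • (x - algebraMap K E c) + c • (z - algebraMap K E c') := by
          simp only [Algebra.smul_def, map_mul]; ring
        rw [this]
        exact M.add_mem (M.add_mem (hMM _ hc _ hc') (M.smul_mem _ hc)) (M.smul_mem _ hc')
      one_mem' := ⟨1, by simp⟩
      add_mem' := by
        rintro x z ⟨c, hc⟩ ⟨c', hc'⟩
        refine ⟨c + c', ?_⟩
        have := M.add_mem hc hc'
        rwa [sub_add_sub_comm, ← map_add] at this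
      zero_mem' := ⟨0, by simp⟩
      neg_mem' := by
        rintro x ⟨c, hc⟩
        refine ⟨-c, ?_⟩
        have := M.neg_mem hc
        rwa [neg_sub', ← map_neg] at this }
  let I : Ideal A :=
    { carrier := {x | (x : E) ∈ M}
      add_mem' := fun hx hz => M.add_mem hx hz
      zero_mem' := M.zero_mem
      smul_mem' := by
        rintro ⟨x, c, hc⟩ ⟨z, hz'⟩ hz
        have hz : z ∈ M := hz
        change x * z ∈ M
        have : x * z = (x - algebraMap K E c) * z + c • z := by
          rw [Algebra.smul_def]; ring
        rw [this]
        exact M.add_mem (hMM _ hc _ hz) (M.smul_mem _ hz) }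
  have hI : I ≠ ⊤ := by
    rw [Ideal.ne_top_iff_one]
    exact h1
  obtain ⟨O, hAO, hideal⟩ := I.image_subset_nonunits_valuationSubring hI
  have hlt : ∀ a ∈ P, O.valuation (mono a) < 1 := by
    intro a ha
    have hmM : mono a ∈ M := Submodule.subset_span ⟨a, ha, rfl⟩
    have : mono a ∈ O.nonunits := hideal ⟨⟨mono a, 0, by simpa using hmM⟩, hmM, rfl⟩
    exact O.mem_nonunits_iff.1 this
  refine ⟨O, fun c hc => ?_, fun a ha => ?_⟩
  · have hle : ∀ c : K, O.valuation (algebraMap K E c) ≤ 1 := fun c =>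
      (O.valuation_le_one_iff _).2 (hAO ⟨c, by simp⟩)
    refine le_antisymm (hle c) ?_
    have h2 := hle c⁻¹
    rw [map_inv₀, map_inv₀] at h2
    have hne : O.valuation (algebraMap K E c) ≠ 0 := by simpa using hc
    rwa [inv_le_one₀ (zero_lt_iff.2 hne)] at h2
  · by_contra hne
    rcases lt_or_gt_of_ne (a := toLex a) (b := 0) (by simpa using hne) with h | h
    · have h3 := hlt (-a) (neg_pos.2 h)
      have h4 : mono a * mono (-a) = 1 := by rw [← hadd]; simp [mono]
      have h5 := congrArg O.valuation h4
      rw [map_mul, map_one, show O.valuation (mono a) = 1 from ha, one_mul] at h5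
      exact h3.ne h5
    · exact (hlt a h).ne ha

section ValuationAux

variable {K E Γ₀ : Type*} [Field K] [Field E] [Algebra K E] [LinearOrderedCommGroupWithZero Γ₀]

/-- A vanishing finite sum whose nonzero terms have distinct values has only zero terms. -/
lemma Valuation.eq_zero_of_sum_eq_zero (w : Valuation E Γ₀) {ι : Type*} [Fintype ι] (z : ι → E)
    (hz : ∀ i j, z i ≠ 0 → z j ≠ 0 → w (z i) = w (z j) → i = j) (hsum : ∑ i, z i = 0) :
    ∀ i, z i = 0 := by
  classical
  by_contra! h
  obtain ⟨i₀, hi₀⟩ := h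
  obtain ⟨i, -, hi⟩ := Finset.exists_max_image Finset.univ (fun i => w (z i)) ⟨i₀, Finset.mem_univ _⟩
  have hzi : z i ≠ 0 := by
    intro h0
    have := hi i₀ (Finset.mem_univ _)
    simp only [h0, map_zero, le_zero_iff, map_eq_zero] at this
    exact hi₀ this
  have hlt : w (∑ j ∈ Finset.univ.erase i, z j) < w (z i) := by
    refine w.map_sum_lt ((map_ne_zero w).2 hzi) fun j hj => ?_
    refine lt_of_le_of_ne (hi j (Finset.mem_univ _)) fun heq => ?_
    have hzj : z j ≠ 0 := fun h0 => by
      rw [h0, map_zero] at heq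
      exact hzi ((map_eq_zero w).1 heq.symm)
    exact (Finset.mem_erase.1 hj).1 (hz _ _ hzj hzi heq)
  rw [← Finset.add_sum_erase _ _ (Finset.mem_univ i)] at hsum
  rw [eq_neg_of_add_eq_zero_right hsum, Valuation.map_neg] at hlt
  exact hlt.false

variable {d : ℕ} {y : Fin d → E}

lemma Valuation.monomial_injective (w : Valuation E Γ₀) (hy0 : ∀ i, y i ≠ 0)
    (hwy : ∀ a : Fin d → ℤ, w (∏ i, y i ^ a i) = 1 → a = 0) (a b : Fin d →₀ ℕ)
    (h : w (∏ i, y i ^ a i) = w (∏ i, y i ^ b i)) : a = b := by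
  have h0 : w (∏ i, y i ^ b i) ≠ 0 :=
    (map_ne_zero w).2 (Finset.prod_ne_zero_iff.2 fun i _ => pow_ne_zero _ (hy0 i))
  have := hwy (fun i => (a i : ℤ) - b i) (by
    have h1 : ∏ i, y i ^ ((a i : ℤ) - b i) = (∏ i, y i ^ a i) / ∏ i, y i ^ b i := by
      rw [← Finset.prod_div_distrib]
      exact Finset.prod_congr rfl fun i _ => by
        rw [zpow_sub₀ (hy0 i), zpow_natCast, zpow_natCast]
    rw [h1, map_div₀, h, div_self h0])
  ext i
  have := congrFun this i
  simp only [Pi.zero_apply] at this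
  omega

/-- The value of a nonzero polynomial in elements with multiplicatively independent values is the
value of a monomial. -/
lemma Valuation.exists_map_aeval_eq (w : Valuation E Γ₀)
    (hwK : ∀ c : K, c ≠ 0 → w (algebraMap K E c) = 1) (hy0 : ∀ i, y i ≠ 0)
    (hwy : ∀ a : Fin d → ℤ, w (∏ i, y i ^ a i) = 1 → a = 0)
    (p : MvPolynomial (Fin d) K) (hp : p ≠ 0) :
    ∃ a : Fin d →₀ ℕ, p.coeff a ≠ 0 ∧ w (MvPolynomial.aeval y p) = w (∏ i, y i ^ a i) ∧
      (∀ b, p.coeff b ≠ 0 → w (∏ i, y i ^ b i) ≤ w (∏ i, y i ^ a i)) ∧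
      w (MvPolynomial.aeval y p - algebraMap K E (p.coeff a) * ∏ i, y i ^ a i)
        < w (∏ i, y i ^ a i) := by
  classical
  obtain ⟨a, ha, hmax⟩ := Finset.exists_max_image p.support
    (fun a => w (∏ i, y i ^ a i)) (MvPolynomial.support_nonempty.2 hp)
  have ha' : p.coeff a ≠ 0 := MvPolynomial.mem_support_iff.1 ha
  have h0 : w (∏ i, y i ^ a i) ≠ 0 :=
    (map_ne_zero w).2 (Finset.prod_ne_zero_iff.2 fun i _ => pow_ne_zero _ (hy0 i))
  have hval : ∀ c : K, c ≠ 0 → ∀ b : Fin d →₀ ℕ,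
      w (algebraMap K E c * ∏ i, y i ^ b i) = w (∏ i, y i ^ b i) := fun c hc b => by
    rw [map_mul, hwK c hc, one_mul]
  have hlt : w (MvPolynomial.aeval y p - algebraMap K E (p.coeff a) * ∏ i, y i ^ a i)
        < w (∏ i, y i ^ a i) := by
    have : MvPolynomial.aeval y p - algebraMap K E (p.coeff a) * ∏ i, y i ^ a i
        = ∑ b ∈ p.support.erase a, algebraMap K E (p.coeff b) * ∏ i, y i ^ b i := by
      rw [MvPolynomial.aeval_def, MvPolynomial.eval₂_eq', ← Finset.add_sum_erase _ _ ha]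
      simp
    rw [this]
    refine w.map_sum_lt h0 fun b hb => ?_
    obtain ⟨hba, hb⟩ := Finset.mem_erase.1 hb
    rw [hval _ (MvPolynomial.mem_support_iff.1 hb)]
    exact lt_of_le_of_ne (hmax b hb) fun h => hba (w.monomial_injective hy0 hwy _ _ h)
  refine ⟨a, ha', ?_, fun b hb => hmax b (MvPolynomial.mem_support_iff.2 hb), hlt⟩
  have := w.map_add_eq_of_lt_right (x := MvPolynomial.aeval y p -
    algebraMap K E (p.coeff a) * ∏ i, y i ^ a i) (y := algebraMap K E (p.coeff a) * ∏ i, y i ^ a i)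
    (by rwa [hval _ ha'])
  rwa [sub_add_cancel, hval _ ha'] at this

/-- Elements that are dependent over the polynomials in `y` cannot have all their `K`-combinations
of the same value. -/
lemma Valuation.not_pure_of_sum_aeval_eq_zero (w : Valuation E Γ₀)
    (hwK : ∀ c : K, c ≠ 0 → w (algebraMap K E c) = 1) (hy0 : ∀ i, y i ≠ 0)
    (hwy : ∀ a : Fin d → ℤ, w (∏ i, y i ^ a i) = 1 → a = 0) {ι : Type*} [Fintype ι]
    (x : ι → E) (g : ι → MvPolynomial (Fin d) K) (hg : g ≠ 0)
    (hsum : ∑ i, MvPolynomial.aeval y (g i) * x i = 0) {γ : Γ₀} (hγ : γ ≠ 0)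
    (hx : ∀ c : ι → K, c ≠ 0 → w (∑ i, c i • x i) = γ) : False := by
  classical
  obtain ⟨i₀, hi₀⟩ : ∃ i, g i ≠ 0 := by
    by_contra! h
    exact hg (funext h)
  have hxi : ∀ i, w (x i) = γ := fun i => by
    have := hx (Pi.single i 1) (by simp)
    rwa [Finset.sum_eq_single i (fun j _ hj => by simp [Pi.single_eq_of_ne hj]) (by simp),
      Pi.single_eq_same, one_smul] at this
  obtain ⟨i, -, himax⟩ := Finset.exists_max_image Finset.univ
    (fun i => w (MvPolynomial.aeval y (g i))) ⟨i₀, Finset.mem_univ _⟩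
  have hgi : g i ≠ 0 := by
    intro h0
    obtain ⟨b, -, hb, -⟩ := w.exists_map_aeval_eq hwK hy0 hwy (g i₀) hi₀
    have h1 := himax i₀ (Finset.mem_univ _)
    rw [h0, map_zero, map_zero, le_zero_iff, hb, map_eq_zero] at h1
    exact Finset.prod_ne_zero_iff.2 (fun i _ => pow_ne_zero _ (hy0 i)) h1
  obtain ⟨a, ha, hwa, -, -⟩ := w.exists_map_aeval_eq hwK hy0 hwy (g i) hgi
  have h0 : w (∏ i, y i ^ a i) ≠ 0 :=
    (map_ne_zero w).2 (Finset.prod_ne_zero_iff.2 fun i _ => pow_ne_zero _ (hy0 i))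
  have hlt : ∀ j, w (MvPolynomial.aeval y (g j) -
      algebraMap K E ((g j).coeff a) * ∏ i, y i ^ a i) < w (∏ i, y i ^ a i) := by
    intro j
    by_cases hj : g j = 0
    · simpa [hj] using zero_lt_iff.2 h0
    obtain ⟨b, hb, hwb, hbmax, hblt⟩ := w.exists_map_aeval_eq hwK hy0 hwy (g j) hj
    have hle := himax j (Finset.mem_univ _)
    rw [hwa, hwb] at hle
    by_cases hab : b = a
    · rwa [hab] at hblt
    have hlt : w (∏ i, y i ^ b i) < w (∏ i, y i ^ a i) :=
      lt_of_le_of_ne hle fun h => hab (w.monomial_injective hy0 hwy _ _ h)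
    have hca : (g j).coeff a = 0 := by
      by_contra h
      exact (hbmax a h).not_gt hlt
    rw [hca, map_zero, zero_mul, sub_zero, hwb]
    exact hlt
  have hc : (fun j => (g j).coeff a) ≠ 0 := fun h => ha (congrFun h i)
  have h1 : w (∑ j, (MvPolynomial.aeval y (g j) -
      algebraMap K E ((g j).coeff a) * ∏ i, y i ^ a i) * x j) < w (∏ i, y i ^ a i) * γ := by
    refine w.map_sum_lt (mul_ne_zero h0 hγ) fun j _ => ?_
    rw [map_mul, hxi]
    exact mul_lt_mul_of_pos_right (hlt j) (zero_lt_iff.2 hγ)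
  have h2 : ∑ j, (MvPolynomial.aeval y (g j) -
      algebraMap K E ((g j).coeff a) * ∏ i, y i ^ a i) * x j =
      - ((∏ i, y i ^ a i) * ∑ j, (g j).coeff a • x j) := by
    simp only [sub_mul, Finset.sum_sub_distrib, hsum, zero_sub, Finset.mul_sum, Algebra.smul_def]
    congr 1
    exact Finset.sum_congr rfl fun j _ => by ring
  rw [h2, Valuation.map_neg, map_mul, hx _ hc] at h1
  exact h1.false

/-- Among elements that are dependent over the polynomials in `y`, two have values that agree up
to the value of a Laurent monomial. -/
lemma Valuation.exists_eq_mul_monomial_of_sum_aeval_eq_zero (w : Valuation E Γ₀)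
    (hwK : ∀ c : K, c ≠ 0 → w (algebraMap K E c) = 1) (hy0 : ∀ i, y i ≠ 0)
    (hwy : ∀ a : Fin d → ℤ, w (∏ i, y i ^ a i) = 1 → a = 0) {ι : Type*} [Fintype ι]
    (x : ι → E) (hx : ∀ i, x i ≠ 0) (g : ι → MvPolynomial (Fin d) K) (hg : g ≠ 0)
    (hsum : ∑ i, MvPolynomial.aeval y (g i) * x i = 0) :
    ∃ i j, i ≠ j ∧ ∃ a : Fin d → ℤ, w (x i) = w (x j) * w (∏ i, y i ^ a i) := by
  by_contra! h
  have key := w.eq_zero_of_sum_eq_zero (fun i => MvPolynomial.aeval y (g i) * x i) (by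
    intro i j hi hj hij
    by_contra hne
    have hgi : g i ≠ 0 := by rintro h0; simp [h0] at hi
    have hgj : g j ≠ 0 := by rintro h0; simp [h0] at hj
    obtain ⟨a, -, ha, -⟩ := w.exists_map_aeval_eq hwK hy0 hwy (g i) hgi
    obtain ⟨b, -, hb, -⟩ := w.exists_map_aeval_eq hwK hy0 hwy (g j) hgj
    simp only [map_mul, ha, hb] at hij
    have h0 : ∀ a : Fin d →₀ ℕ, w (∏ i, y i ^ a i) ≠ 0 := fun a =>
      (map_ne_zero w).2 (Finset.prod_ne_zero_iff.2 fun i _ => pow_ne_zero _ (hy0 i))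
    refine h i j hne (fun i => (b i : ℤ) - a i) ?_
    have h1 : ∏ i, y i ^ ((b i : ℤ) - a i) = (∏ i, y i ^ b i) / ∏ i, y i ^ a i := by
      rw [← Finset.prod_div_distrib]
      exact Finset.prod_congr rfl fun i _ => by
        rw [zpow_sub₀ (hy0 i), zpow_natCast, zpow_natCast]
    rw [h1, map_div₀, mul_div_assoc', eq_div_iff (h0 a), mul_comm (w (x i)), hij, mul_comm]) hsum
  refine hg (funext fun i => ?_)
  by_contra hgi
  obtain ⟨a, -, ha, -⟩ := w.exists_map_aeval_eq hwK hy0 hwy (g i) hgi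
  have h2 := (mul_eq_zero.1 (key i)).resolve_right (hx i)
  rw [h2, map_zero] at ha
  exact Finset.prod_ne_zero_iff.2 (fun i _ => pow_ne_zero _ (hy0 i)) ((map_eq_zero w).1 ha.symm)

/-- A subspace of a finite-dimensional subspace has a complement in it. -/
lemma Submodule.exists_disjoint_finrank_add_eq {U' U : Submodule K E} [FiniteDimensional K U]
    (h : U' ≤ U) : ∃ W ≤ U, Disjoint U' W ∧ finrank K U' + finrank K W = finrank K U := by
  obtain ⟨W₀, hW₀⟩ := Submodule.exists_isCompl U'
  have hdisj : Disjoint U' (W₀ ⊓ U) := hW₀.disjoint.mono_right inf_le_left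
  have hsup : U' ⊔ W₀ ⊓ U = U := by
    rw [← sup_inf_assoc_of_le _ h, hW₀.sup_eq_top, top_inf_eq]
  have : FiniteDimensional K U' := Submodule.finiteDimensional_of_le h
  have : FiniteDimensional K (W₀ ⊓ U : Submodule K E) :=
    Submodule.finiteDimensional_of_le inf_le_right
  have hrank := Submodule.finrank_sup_add_finrank_inf_eq U' (W₀ ⊓ U)
  rw [hsup, hdisj.eq_bot, finrank_bot, add_zero] at hrank
  exact ⟨W₀ ⊓ U, inf_le_right, hdisj, hrank.symm⟩

/-- If all families in `U` whose nontrivial combinations share a single value have at most `D`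
members, then `dim U` is at most `D` times the number of values on `U`. -/
lemma Valuation.exists_finset_finrank_le (w : Valuation E Γ₀)
    (hwK : ∀ c : K, c ≠ 0 → w (algebraMap K E c) = 1) (D : ℕ) (U : Submodule K E)
    [FiniteDimensional K U]
    (hD : ∀ (s : ℕ) (u : Fin s → E) (γ : Γ₀), (∀ j, u j ∈ U) → γ ≠ 0 →
      (∀ c : Fin s → K, c ≠ 0 → w (∑ j, c j • u j) = γ) → s ≤ D) :
    ∃ T : Finset E, (∀ t ∈ T, t ∈ U ∧ t ≠ 0) ∧ Set.InjOn w T ∧ finrank K U ≤ D * T.card := by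
  classical
  induction hn : finrank K U using Nat.strong_induction_on generalizing U with
  | _ n ih =>
  subst hn
  have hle1 : ∀ c : K, w (algebraMap K E c) ≤ 1 := fun c => by
    by_cases hc : c = 0
    · simp [hc]
    · exact (hwK c hc).le
  by_cases hU : finrank K U = 0
  · exact ⟨∅, by simp, by simp, by simp [hU]⟩
  have hpos : 0 < finrank K U := Nat.pos_of_ne_zero hU
  let b := Module.finBasis K U
  obtain ⟨i, -, hi⟩ := Finset.exists_max_image Finset.univ (fun i => w (b i : E))
    ⟨⟨0, hpos⟩, Finset.mem_univ _⟩
  have hbi : (b i : E) ≠ 0 := fun h => b.ne_zero i (Subtype.ext h)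
  have hα : w (b i : E) ≠ 0 := (map_ne_zero w).2 hbi
  have hmax : ∀ z ∈ U, w z ≤ w (b i : E) := by
    intro z hz
    have h1 := congrArg (Subtype.val) (b.sum_repr ⟨z, hz⟩)
    simp only [AddSubmonoidClass.coe_finsetSum, Submodule.coe_smul] at h1
    rw [← h1]
    refine w.map_sum_le fun j _ => ?_
    rw [Algebra.smul_def, map_mul]
    exact (mul_le_mul' (hle1 _) (hi j (Finset.mem_univ _))).trans (one_mul _).le
  let U' : Submodule K E :=
    { carrier := {z | z ∈ U ∧ w z < w (b i : E)}
      add_mem' := fun hx hz => ⟨U.add_mem hx.1 hz.1, w.map_add_lt hx.2 hz.2⟩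
      zero_mem' := ⟨U.zero_mem, by simpa using zero_lt_iff.2 hα⟩
      smul_mem' := fun c z hz => ⟨U.smul_mem c hz.1, by
        rw [Algebra.smul_def, map_mul]
        exact (mul_le_mul_left (hle1 c) _).trans_lt (by rw [one_mul]; exact hz.2)⟩ }
  have hU'U : U' ≤ U := fun z hz => hz.1
  have hfd : FiniteDimensional K U' := Submodule.finiteDimensional_of_le hU'U
  have hlt : U' < U := lt_of_le_of_ne hU'U fun h => by
    have : (b i : E) ∈ U' := h.ge (b i).2
    exact this.2.false
  obtain ⟨T, hT, hTinj, hTcard⟩ := ih _ (Submodule.finrank_lt_finrank_of_lt hlt) U'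
    (fun s u γ hu => hD s u γ fun j => hU'U (hu j)) rfl
  obtain ⟨W, hWU, hdisj, hsum⟩ := Submodule.exists_disjoint_finrank_add_eq hU'U
  have hfdW : FiniteDimensional K W := Submodule.finiteDimensional_of_le hWU
  have hWD : finrank K W ≤ D := by
    let c := Module.finBasis K W
    refine hD _ (fun j => (c j : E)) (w (b i : E)) (fun j => hWU (c j).2) hα ?_
    intro a ha
    have hmem : ∑ j, a j • c j ≠ 0 := fun h0 =>
      ha (funext (Fintype.linearIndependent_iff.1 c.linearIndependent a h0))
    have hcoe : ∑ j, a j • (c j : E) = ((∑ j, a j • c j : W) : E) := by simp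
    rw [hcoe]
    refine le_antisymm (hmax _ (hWU (Subtype.mem _))) (not_lt.1 fun h => hmem ?_)
    exact Subtype.ext (Submodule.disjoint_def.1 hdisj _ ⟨hWU (Subtype.mem _), h⟩ (Subtype.mem _))
  have hnot : (b i : E) ∉ T := fun h => (hT _ h).1.2.false
  refine ⟨insert (b i : E) T, ?_, ?_, ?_⟩
  · intro t ht
    rcases Finset.mem_insert.1 ht with rfl | ht
    · exact ⟨(b i).2, hbi⟩
    · exact ⟨hU'U (hT t ht).1, (hT t ht).2⟩
  · rw [Finset.coe_insert, Set.injOn_insert (by simpa using hnot)]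
    refine ⟨hTinj, ?_⟩
    rintro ⟨t, ht, h⟩
    exact ((hT t ht).1.2).ne h
  · rw [Finset.card_insert_of_notMem hnot]
    linarith [mul_add D T.card 1]

end ValuationAux

section SubspaceGrading

variable {K E : Type*} [Field K] [Field E] [Algebra K E] {V : ℕ → Submodule K E}

lemma Submodule.prod_mem_of_graded (h1 : (1 : E) ∈ V 0)
    (hmul : ∀ m n x z, x ∈ V m → z ∈ V n → x * z ∈ V (m + n)) {ι : Type*} (s : Finset ι)
    (n : ι → ℕ) (x : ι → E) (hx : ∀ i ∈ s, x i ∈ V (n i)) : ∏ i ∈ s, x i ∈ V (∑ i ∈ s, n i) := by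
  classical
  induction s using Finset.induction_on with
  | empty => simpa using h1
  | insert i s hi ih =>
    rw [Finset.prod_insert hi, Finset.sum_insert hi]
    exact hmul _ _ _ _ (hx i (Finset.mem_insert_self _ _))
      (ih fun j hj => hx j (Finset.mem_insert_of_mem hj))

lemma Submodule.pow_mem_of_graded (h1 : (1 : E) ∈ V 0)
    (hmul : ∀ m n x z, x ∈ V m → z ∈ V n → x * z ∈ V (m + n)) {n : ℕ} {x : E} (hx : x ∈ V n)
    (k : ℕ) : x ^ k ∈ V (k * n) := by
  have := Submodule.prod_mem_of_graded h1 hmul (Finset.range k) (fun _ => n) (fun _ => x)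
    (fun _ _ => hx)
  simpa using this

variable {Γ₀ : Type*} [LinearOrderedCommGroupWithZero Γ₀]

/-- The group of values of quotients of homogeneous elements of the same degree. -/
def ratioValueGroup (w : Valuation E Γ₀) (V : ℕ → Submodule K E) (h1 : (1 : E) ∈ V 0)
    (hmul : ∀ m n x z, x ∈ V m → z ∈ V n → x * z ∈ V (m + n)) :
    AddSubgroup (Additive Γ₀ˣ) where
  carrier := {g | ∃ n, ∃ x ∈ V n, ∃ z ∈ V n, x ≠ 0 ∧ z ≠ 0 ∧ ((g.toMul : Γ₀ˣ) : Γ₀) = w x / w z}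
  add_mem' := by
    rintro g g' ⟨n, x, hx, z, hz, hx0, hz0, h⟩ ⟨n', x', hx', z', hz', hx0', hz0', h'⟩
    refine ⟨n + n', x * x', hmul _ _ _ _ hx hx', z * z', hmul _ _ _ _ hz hz',
      mul_ne_zero hx0 hx0', mul_ne_zero hz0 hz0', ?_⟩
    rw [toMul_add, Units.val_mul, h, h', map_mul, map_mul, div_mul_div_comm]
  zero_mem' := ⟨0, 1, h1, 1, h1, one_ne_zero, one_ne_zero, by simp⟩
  neg_mem' := by
    rintro g ⟨n, x, hx, z, hz, hx0, hz0, h⟩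
    refine ⟨n, z, hz, x, hx, hz0, hx0, ?_⟩
    rw [toMul_neg, Units.val_inv_eq_inv_val, h, inv_div]

variable {d : ℕ} {y : Fin d → E}

lemma Valuation.coe_toMul_sum_zsmul (w : Valuation E Γ₀) (hy0 : ∀ i, y i ≠ 0) (a : Fin d → ℤ) :
    ((Additive.toMul (∑ i, a i • Additive.ofMul (Units.mk0 (w (y i))
      ((map_ne_zero w).2 (hy0 i)))) : Γ₀ˣ) : Γ₀) = w (∏ i, y i ^ a i) := by
  simp [toMul_sum, toMul_zsmul, map_prod, map_zpow₀, Units.coe_prod]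

/-- The value group of quotients is a lattice of rank at least the number of independent values,
if all sufficiently large families of elements of the same degree are dependent over the
polynomials. -/
lemma Valuation.exists_basis_ratioValueGroup (w : Valuation E Γ₀)
    (hwK : ∀ c : K, c ≠ 0 → w (algebraMap K E c) = 1) (h1 : (1 : E) ∈ V 0)
    (hmul : ∀ m n x z, x ∈ V m → z ∈ V n → x * z ∈ V (m + n)) (hy0 : ∀ i, y i ≠ 0)
    (hwy : ∀ a : Fin d → ℤ, w (∏ i, y i ^ a i) = 1 → a = 0)
    (hy : ∀ i, ∃ n, ∃ x ∈ V n, ∃ z ∈ V n, z ≠ 0 ∧ y i * z = x) (r : ℕ)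
    (hR : ∀ n (x : Fin (r + 1) → E), (∀ i, x i ∈ V n) →
      ∃ g : Fin (r + 1) → MvPolynomial (Fin d) K, g ≠ 0 ∧
        ∑ i, MvPolynomial.aeval y (g i) * x i = 0) :
    ∃ d', d ≤ d' ∧ Nonempty
      (Module.Basis (Fin d') ℤ (ratioValueGroup w V h1 hmul).toIntSubmodule) := by
  classical
  set L := (ratioValueGroup w V h1 hmul).toIntSubmodule with hL
  let μ : Fin d → L := fun i =>
    ⟨Additive.ofMul (Units.mk0 (w (y i)) ((map_ne_zero w).2 (hy0 i))), by
      obtain ⟨n, x, hx, z, hz, hz0, h⟩ := hy i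
      refine ⟨n, x, hx, z, hz, h ▸ mul_ne_zero (hy0 i) hz0, hz0, ?_⟩
      rw [← h, map_mul, mul_div_cancel_right₀ _ ((map_ne_zero w).2 hz0)]
      rfl⟩
  have hμ : ∀ a : Fin d → ℤ, (((∑ i, a i • μ i : L) : Additive Γ₀ˣ).toMul : Γ₀)
      = w (∏ i, y i ^ a i) := fun a => by
    rw [← w.coe_toMul_sum_zsmul hy0 a]
    simp [μ]
  have hμind : LinearIndependent ℤ μ := by
    rw [Fintype.linearIndependent_iff]
    intro a ha
    have := hμ a
    rw [ha] at this
    exact congrFun (hwy a (by rw [← this]; simp))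
  let M : Submodule ℤ L := Submodule.span ℤ (Set.range μ)
  have hcol : ∀ f : Fin (r + 1) → L, ∃ i j, i ≠ j ∧ f i - f j ∈ M := by
    intro f
    have hf : ∀ i, ∃ n, ∃ x ∈ V n, ∃ z ∈ V n, x ≠ 0 ∧ z ≠ 0 ∧
      (((f i : Additive Γ₀ˣ).toMul : Γ₀ˣ) : Γ₀) = w x / w z := fun i => (f i).2
    choose n x hx z hz hx0 hz0 hxz using hf
    let X : Fin (r + 1) → E := fun i => x i * ∏ j ∈ Finset.univ.erase i, z j
    have hX0 : ∀ i, X i ≠ 0 := fun i =>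
      mul_ne_zero (hx0 i) (Finset.prod_ne_zero_iff.2 fun j _ => hz0 j)
    have hX : ∀ i, X i ∈ V (∑ j, n j) := fun i => by
      rw [← Finset.add_sum_erase _ _ (Finset.mem_univ i)]
      exact hmul _ _ _ _ (hx i) (Submodule.prod_mem_of_graded h1 hmul _ _ _ fun j _ => hz j)
    have hwX : ∀ i, w (X i) = (((f i : Additive Γ₀ˣ).toMul : Γ₀ˣ) : Γ₀) * w (∏ j, z j) := fun i => by
      rw [hxz, ← Finset.mul_prod_erase _ _ (Finset.mem_univ i), map_mul, map_mul, ← mul_assoc,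
        div_mul_cancel₀ _ ((map_ne_zero w).2 (hz0 i))]
    have hZ : w (∏ j, z j) ≠ 0 := (map_ne_zero w).2 (Finset.prod_ne_zero_iff.2 fun j _ => hz0 j)
    obtain ⟨g, hg, hsum⟩ := hR _ X hX
    obtain ⟨i, j, hij, a, ha⟩ :=
      w.exists_eq_mul_monomial_of_sum_aeval_eq_zero hwK hy0 hwy X hX0 g hg hsum
    refine ⟨i, j, hij, ?_⟩
    have : f i - f j = ∑ i, a i • μ i := by
      rw [sub_eq_iff_eq_add]
      apply Subtype.ext
      apply Additive.toMul.injective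
      apply Units.ext
      rw [Submodule.coe_add, toMul_add, Units.val_mul, hμ]
      rw [hwX, hwX, mul_right_comm] at ha
      rw [mul_right_cancel₀ hZ ha, mul_comm]
    rw [this]
    exact Submodule.sum_mem _ fun i _ => M.smul_mem _ (Submodule.subset_span ⟨i, rfl⟩)
  have hfin : Finite (L ⧸ M) := by
    by_contra h
    rw [not_finite_iff_infinite] at h
    let φ := Infinite.natEmbedding (L ⧸ M)
    obtain ⟨f, hf⟩ : ∃ f : Fin (r + 1) → L, ∀ i, M.mkQ (f i) = φ i :=
      ⟨fun i => (M.mkQ_surjective (φ i)).choose, fun i => (M.mkQ_surjective (φ i)).choose_spec⟩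
    obtain ⟨i, j, hij, hM⟩ := hcol f
    refine hij (Fin.ext (φ.injective ?_))
    rw [← hf, ← hf]
    exact (Submodule.Quotient.eq M).2 hM
  have hMfin : Module.Finite ℤ M := Module.Finite.span_of_finite ℤ (Set.finite_range μ)
  have hLfin : Module.Finite ℤ L := Module.Finite.of_submodule_quotient M
  exact ⟨finrank ℤ L, by simpa using hμind.fintype_card_le_finrank, ⟨Module.finBasis ℤ L⟩⟩

/-- There are quotients of elements of the same degree whose small powers separate the values of
`k`-th powers. -/
lemma Valuation.exists_separating (w : Valuation E Γ₀)
    (hwK : ∀ c : K, c ≠ 0 → w (algebraMap K E c) = 1) (h1 : (1 : E) ∈ V 0)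
    (hmul : ∀ m n x z, x ∈ V m → z ∈ V n → x * z ∈ V (m + n))
    (hP : ∃ J, ∀ s ≥ J, ∃ e ∈ V s, e ≠ 0) (hy0 : ∀ i, y i ≠ 0)
    (hwy : ∀ a : Fin d → ℤ, w (∏ i, y i ^ a i) = 1 → a = 0)
    (hy : ∀ i, ∃ n, ∃ x ∈ V n, ∃ z ∈ V n, z ≠ 0 ∧ y i * z = x) (r : ℕ)
    (hR : ∀ n (x : Fin (r + 1) → E), (∀ i, x i ∈ V n) →
      ∃ g : Fin (r + 1) → MvPolynomial (Fin d) K, g ≠ 0 ∧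
        ∑ i, MvPolynomial.aeval y (g i) * x i = 0) :
    ∃ d', d ≤ d' ∧ ∃ c₀, ∀ c ≥ c₀, ∃ X X₀ : Fin d' → E,
      (∀ i, X i ∈ V c ∧ X i ≠ 0 ∧ X₀ i ∈ V c ∧ X₀ i ≠ 0) ∧
      ∀ m k (x x' : E), x ∈ V m → x' ∈ V m → x ≠ 0 → x' ≠ 0 → ∀ a a' : Fin d' → Fin k,
        w (x ^ k * ∏ i, (X i ^ (a i : ℕ) * X₀ i ^ (k - a i))) =
          w (x' ^ k * ∏ i, (X i ^ (a' i : ℕ) * X₀ i ^ (k - a' i))) → w x = w x' ∧ a = a' := by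
  classical
  obtain ⟨d', hd', ⟨b⟩⟩ := w.exists_basis_ratioValueGroup hwK h1 hmul hy0 hwy hy r hR
  set L := (ratioValueGroup w V h1 hmul).toIntSubmodule with hL
  obtain ⟨J, hJ⟩ := hP
  have hb : ∀ i, ∃ n, ∃ x ∈ V n, ∃ z ∈ V n, x ≠ 0 ∧ z ≠ 0 ∧
      (((b i : Additive Γ₀ˣ).toMul : Γ₀ˣ) : Γ₀) = w x / w z := fun i => (b i).2
  choose n x hx z hz hx0 hz0 hxz using hb
  refine ⟨d', hd', ∑ i, n i + J, fun c hc => ?_⟩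
  have hn : ∀ i, n i + J ≤ c := fun i =>
    (Nat.add_le_add_right (Finset.single_le_sum (f := n) (fun _ _ => Nat.zero_le _)
      (Finset.mem_univ i)) J).trans hc
  have he : ∀ i, ∃ e ∈ V (c - n i), e ≠ 0 := fun i => hJ _ (by have := hn i; omega)
  choose e he he0 using he
  have hce : ∀ i, n i + (c - n i) = c := fun i => by have := hn i; omega
  refine ⟨fun i => x i * e i, fun i => z i * e i, fun i =>
    ⟨hce i ▸ hmul _ _ _ _ (hx i) (he i), mul_ne_zero (hx0 i) (he0 i),
      hce i ▸ hmul _ _ _ _ (hz i) (he i), mul_ne_zero (hz0 i) (he0 i)⟩, ?_⟩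
  intro m k u u' hu hu' hu0 hu0' a a' h
  let β : Fin d' → Γ₀ := fun i => (((b i : Additive Γ₀ˣ).toMul : Γ₀ˣ) : Γ₀)
  have hterm : ∀ a : Fin d' → Fin k, w (∏ i, ((x i * e i) ^ (a i : ℕ) * (z i * e i) ^ (k - a i)))
      = (∏ i, β i ^ (a i : ℕ)) * ∏ i, w (z i * e i) ^ k := by
    intro a
    rw [map_prod, ← Finset.prod_mul_distrib]
    refine Finset.prod_congr rfl fun i _ => ?_
    have hwx : w (x i * e i) = β i * w (z i * e i) := by
      simp only [β, hxz, map_mul]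
      rw [← mul_assoc, div_mul_cancel₀ _ ((map_ne_zero w).2 (hz0 i))]
    rw [map_mul, map_pow, map_pow, hwx, mul_pow, mul_assoc, ← pow_add,
      Nat.add_sub_cancel' (a i).2.le]
  have hZ : ∏ i, w (z i * e i) ^ k ≠ 0 := Finset.prod_ne_zero_iff.2 fun i _ =>
    pow_ne_zero _ ((map_ne_zero w).2 (mul_ne_zero (hz0 i) (he0 i)))
  rw [map_mul, map_mul, hterm, hterm, ← mul_assoc, ← mul_assoc, map_pow, map_pow] at h
  have h := mul_right_cancel₀ hZ h
  let g : L := ⟨Additive.ofMul (Units.mk0 (w u) ((map_ne_zero w).2 hu0) /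
    Units.mk0 (w u') ((map_ne_zero w).2 hu0')), ⟨m, u, hu, u', hu', hu0, hu0', by simp⟩⟩
  have hrel : (k : ℤ) • g + ∑ i, (((a i : ℕ) : ℤ) - ((a' i : ℕ) : ℤ)) • b i = 0 := by
    simp only [sub_smul, Finset.sum_sub_distrib]
    rw [← add_sub_assoc, sub_eq_zero]
    apply Subtype.ext
    apply Additive.toMul.injective
    apply Units.ext
    have hsum : ∀ a : Fin d' → Fin k,
        ((((∑ i, ((a i : ℕ) : ℤ) • b i : L) : Additive Γ₀ˣ).toMul : Γ₀ˣ) : Γ₀)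
          = ∏ i, β i ^ (a i : ℕ) := by
      intro a
      simp [β, toMul_sum]
    have hg : ((((((k : ℤ) • g : L)) : Additive Γ₀ˣ).toMul : Γ₀ˣ) : Γ₀) = (w u / w u') ^ k := by
      simp [g]
    rw [Submodule.coe_add, toMul_add, Units.val_mul, hsum, hsum, hg, div_pow, div_mul_eq_mul_div,
      h, mul_div_cancel_left₀ _ (pow_ne_zero _ ((map_ne_zero w).2 hu0'))]
  have hcoord : ∀ i, (k : ℤ) * b.repr g i + (((a i : ℕ) : ℤ) - ((a' i : ℕ) : ℤ)) = 0 := by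
    intro i
    have := congrArg (fun v => b.repr v i) hrel
    simp only [map_add, map_smul, map_sum, Module.Basis.repr_self, map_zero, Finsupp.coe_add,
      Pi.add_apply, Finsupp.coe_smul, Pi.smul_apply, smul_eq_mul, Finsupp.coe_zero, Pi.zero_apply,
      Finsupp.finsetSum_apply] at this
    rw [Finset.sum_eq_single i (fun j _ hj => by simp [hj]) (by simp)] at this
    simpa using this
  have haa : ∀ i, a i = a' i ∧ b.repr g i = 0 := by
    intro i
    have h2 := hcoord i
    have h3 := (a i).2
    have h4 := (a' i).2
    have h5 : b.repr g i = 0 := by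
      by_contra hne
      rcases lt_or_gt_of_ne hne with hlt | hlt
      · have : (k : ℤ) * b.repr g i ≤ k * (-1) :=
          mul_le_mul_of_nonneg_left (by omega) (by positivity)
        omega
      · have : (k : ℤ) * 1 ≤ k * b.repr g i :=
          mul_le_mul_of_nonneg_left (by omega) (by positivity)
        omega
    rw [h5] at h2
    exact ⟨Fin.ext (by omega), h5⟩
  have hg0 : g = 0 := b.repr.map_eq_zero_iff.1 (Finsupp.ext fun i => (haa i).2)
  refine ⟨?_, funext fun i => (haa i).1⟩
  have := congrArg (fun v : L => (((v : Additive Γ₀ˣ).toMul : Γ₀ˣ) : Γ₀)) hg0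
  simp only [g, toMul_ofMul, Submodule.coe_zero, toMul_zero, Units.val_one,
    Units.val_div_eq_div_val, Units.val_mk0] at this
  exact (div_eq_one_iff_eq ((map_ne_zero w).2 hu0')).1 this

end SubspaceGrading

section GrowthBound

variable {K E : Type*} [Field K] [Field E] [Algebra K E] {V : ℕ → Submodule K E}
  {d : ℕ} {y : Fin d → E}

lemma Valuation.linearIndependent_mul_of_pure {Γ₀ : Type*} [LinearOrderedCommGroupWithZero Γ₀]
    (w : Valuation E Γ₀) {ι : Type*} [Fintype ι] {D : ℕ} {z : ι → E} {u : Fin D → E} {γ : Γ₀}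
    (hz0 : ∀ i, z i ≠ 0) (hz : Function.Injective fun i => w (z i)) (hγ : γ ≠ 0)
    (hu : ∀ c : Fin D → K, c ≠ 0 → w (∑ j, c j • u j) = γ) :
    LinearIndependent K fun q : ι × Fin D => z q.1 * u q.2 := by
  classical
  rw [Fintype.linearIndependent_iff]
  intro c hc
  have hval : ∀ i, z i * ∑ j, c (i, j) • u j ≠ 0 → w (∑ j, c (i, j) • u j) = γ := by
    intro i hi
    refine hu (fun j => c (i, j)) fun h => hi ?_
    have : ∀ j, c (i, j) = 0 := fun j => congrFun h j
    simp [this]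
  have h0 := w.eq_zero_of_sum_eq_zero (fun i => z i * ∑ j, c (i, j) • u j)
    (fun i i' hi hi' h => by
      rw [map_mul, map_mul, hval i hi, hval i' hi'] at h
      exact hz (mul_right_cancel₀ hγ h))
    (by
      rw [← hc, Fintype.sum_prod_type]
      exact Finset.sum_congr rfl fun i _ => by
        rw [Finset.mul_sum]
        exact Finset.sum_congr rfl fun j _ => by rw [mul_smul_comm])
  rintro ⟨i, j⟩
  by_contra hij
  have h1 : ∑ j, c (i, j) • u j = 0 := (mul_eq_zero.1 (h0 i)).resolve_left (hz0 i)
  have h2 := hu (fun j => c (i, j)) fun h => hij (congrFun h j)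
  rw [h1, map_zero] at h2
  exact hγ h2.symm

lemma AlgebraicIndependent.exists_pow_mul_finrank_le (hyi : AlgebraicIndependent K y)
    (hfin : ∀ n, FiniteDimensional K (V n)) (h1 : (1 : E) ∈ V 0)
    (hmul : ∀ m n x z, x ∈ V m → z ∈ V n → x * z ∈ V (m + n))
    (hP : ∃ J, ∀ s ≥ J, ∃ e ∈ V s, e ≠ 0)
    (hy : ∀ i, ∃ n, ∃ x ∈ V n, ∃ z ∈ V n, z ≠ 0 ∧ y i * z = x) (r : ℕ)
    (hR : ∀ n (x : Fin (r + 1) → E), (∀ i, x i ∈ V n) →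
      ∃ g : Fin (r + 1) → MvPolynomial (Fin d) K, g ≠ 0 ∧
        ∑ i, MvPolynomial.aeval y (g i) * x i = 0) (n₀ : ℕ) :
    ∃ d', d ≤ d' ∧ ∃ D c, n₀ ≤ c ∧ ∃ (X X₀ : Fin d' → E) (u : Fin D → E),
      (∀ i, X i ∈ V c) ∧ (∀ i, X₀ i ∈ V c) ∧ (∀ j, u j ∈ V c) ∧
      ∀ m k, ∀ U ≤ V m, ∀ G : Submodule K E, FiniteDimensional K G → ∀ e : E, e ≠ 0 →
        (∀ x ∈ U, ∀ (a : Fin d' → Fin k) (j : Fin D),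
          x ^ k * (∏ i, (X i ^ (a i : ℕ) * X₀ i ^ (k - a i))) * u j * e ∈ G) →
        k ^ d' * finrank K U ≤ finrank K G := by
  classical
  obtain ⟨O, hwK, hwy⟩ := hyi.exists_valuationSubring
  set w := O.valuation
  have hy0 : ∀ i, y i ≠ 0 := fun i => hyi.ne_zero i
  obtain ⟨d', hd', c₀, hc₀⟩ := w.exists_separating hwK h1 hmul hP hy0 hwy hy r hR
  obtain ⟨J, hJ⟩ := hP
  let P : ℕ → Prop := fun s => ∃ n, ∃ u : Fin s → E, ∃ γ : O.ValueGroup, (∀ j, u j ∈ V n) ∧ γ ≠ 0 ∧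
    ∀ c : Fin s → K, c ≠ 0 → w (∑ j, c j • u j) = γ
  have hPr : ∀ s, P s → s ≤ r := by
    rintro s ⟨n, u, γ, hu, hγ, hpure⟩
    by_contra! hs
    let ι : Fin (r + 1) → Fin s := Fin.castLE hs
    have hι : Function.Injective ι := Fin.castLE_injective hs
    obtain ⟨g, hg, hsum⟩ := hR n (fun i => u (ι i)) fun i => hu _
    refine w.not_pure_of_sum_aeval_eq_zero hwK hy0 hwy (fun i => u (ι i)) g hg hsum hγ fun c hc => ?_
    have := hpure (Function.extend ι c 0) fun h => hc (by
      funext i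
      rw [← hι.extend_apply c 0 i, h]; rfl)
    rw [← this]
    congr 1
    rw [← Finset.sum_subset (Finset.subset_univ (Finset.univ.image ι)),
      Finset.sum_image fun _ _ _ _ h => hι h]
    · simp [hι.extend_apply]
    · intro j _ hj
      rw [Function.extend_apply']
      · simp
      · rintro ⟨i, rfl⟩
        exact hj (Finset.mem_image_of_mem _ (Finset.mem_univ _))
  have hP0 : P 0 := ⟨0, Fin.elim0, 1, fun j => j.elim0, one_ne_zero, fun c hc =>
    (hc (Subsingleton.elim _ _)).elim⟩
  obtain ⟨D, ⟨n, u, γ, hu, hγ, hpure⟩, hD⟩ : ∃ D, P D ∧ ∀ s, P s → s ≤ D :=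
    ⟨Nat.findGreatest P r, Nat.findGreatest_spec (Nat.zero_le r) hP0,
      fun s hs => Nat.le_findGreatest (hPr s hs) hs⟩
  obtain ⟨e₀, he₀, he₀0⟩ := hJ (c₀ + n₀ + J) (by omega)
  obtain ⟨X, X₀, hX, hsep⟩ := hc₀ (n + (c₀ + n₀ + J)) (by omega)
  refine ⟨d', hd', D, n + (c₀ + n₀ + J), by omega, X, X₀, fun j => u j * e₀, fun i => (hX i).1,
    fun i => (hX i).2.2.1, fun j => hmul _ _ _ _ (hu j) he₀, ?_⟩
  intro m k U hU G hG e he hmem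
  have : FiniteDimensional K (V m) := hfin m
  have : FiniteDimensional K U := Submodule.finiteDimensional_of_le hU
  obtain ⟨T, hTU, hTinj, hTcard⟩ := w.exists_finset_finrank_le hwK D U fun s u γ hu hγ hp =>
    hD s ⟨m, u, γ, fun j => hU (hu j), hγ, hp⟩
  let β : (Fin d' → Fin k) → E := fun a => ∏ i, (X i ^ (a i : ℕ) * X₀ i ^ (k - a i))
  have hβ0 : ∀ a, β a ≠ 0 := fun a => Finset.prod_ne_zero_iff.2 fun i _ =>
    mul_ne_zero (pow_ne_zero _ (hX i).2.1) (pow_ne_zero _ (hX i).2.2.2)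
  let z : T × (Fin d' → Fin k) → E := fun q => (q.1 : E) ^ k * β q.2 * (e₀ * e)
  have hz0 : ∀ q, z q ≠ 0 := fun q => mul_ne_zero (mul_ne_zero (pow_ne_zero _ (hTU _ q.1.2).2)
    (hβ0 _)) (mul_ne_zero he₀0 he)
  have hzinj : Function.Injective fun q => w (z q) := by
    rintro ⟨⟨t, ht⟩, a⟩ ⟨⟨t', ht'⟩, a'⟩ h
    simp only [z] at h
    rw [map_mul, map_mul w (t' ^ k * β a')] at h
    have h := mul_right_cancel₀ ((map_ne_zero w).2 (mul_ne_zero he₀0 he)) h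
    obtain ⟨h1, h2⟩ := hsep m k t t' (hU (hTU t ht).1) (hU (hTU t' ht').1) (hTU t ht).2
      (hTU t' ht').2 a a' h
    have : t = t' := hTinj ht ht' h1
    subst this; subst h2; rfl
  have hli := w.linearIndependent_mul_of_pure hz0 hzinj hγ hpure
  have hcard : Fintype.card ((T × (Fin d' → Fin k)) × Fin D) ≤ finrank K G := by
    have hli' : LinearIndependent K (fun q : (T × (Fin d' → Fin k)) × Fin D =>
        (⟨z q.1 * u q.2, by
          have := hmem q.1.1 (hTU _ q.1.1.2).1 q.1.2 q.2
          convert this using 1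
          simp only [z, β]; ring⟩ : G)) := by
      apply LinearIndependent.of_comp G.subtype
      exact hli
    exact hli'.fintype_card_le_finrank
  simp only [Fintype.card_prod, Fintype.card_coe, Fintype.card_fun, Fintype.card_fin] at hcard
  calc k ^ d' * finrank K U ≤ k ^ d' * (D * T.card) := Nat.mul_le_mul_left _ hTcard
    _ = T.card * k ^ d' * D := by ring
    _ ≤ _ := hcard

end GrowthBound

section FiniteGeneration

variable {K E : Type*} [Field K] [Field E] [Algebra K E]

open scoped IntermediateField.algebraAdjoinAdjoin in
lemma Submodule.exists_algebraicIndependent_fin (W : Submodule K E) [FiniteDimensional K W] :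
    ∃ (d : ℕ) (y : Fin d → E), AlgebraicIndependent K y ∧ (∀ i, y i ∈ W) ∧
      ∀ x ∈ W, IsIntegral (IntermediateField.adjoin K (Set.range y)) x := by
  obtain ⟨s, -, ⟨hs, hsW⟩, hmax⟩ := exists_maximal_algebraicIndependent (R := K) (∅ : Set E)
    (W : Set E) (Set.empty_subset _) (by
      simpa [AlgebraicIndepOn] using (algebraMap K E).injective)
  have hli : LinearIndependent K fun x : s => (⟨x, hsW x.2⟩ : W) :=
    LinearIndependent.of_comp W.subtype (AlgebraicIndependent.linearIndependent hs)
  have hfin : Finite s := hli.finite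
  have := Fintype.ofFinite s
  let φ := (Fintype.equivFin s).symm
  have hrange : Set.range (fun i => (φ i : E)) = s := by
    ext x
    constructor
    · rintro ⟨i, rfl⟩
      exact (φ i).2
    · intro hx
      exact ⟨φ.symm ⟨x, hx⟩, by simp⟩
  refine ⟨Fintype.card s, fun i => φ i, ?_, fun i => hsW (φ i).2, fun x hx => ?_⟩
  · exact AlgebraicIndependent.comp hs φ φ.injective
  rw [hrange, ← isAlgebraic_iff_isIntegral]
  by_cases hxs : x ∈ s
  · exact isAlgebraic_algebraMap
      (⟨x, IntermediateField.subset_adjoin K s hxs⟩ : IntermediateField.adjoin K s)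
  have halg : IsAlgebraic (Algebra.adjoin K s) x := by
    by_contra h
    refine hxs (hmax ⟨?_, Set.insert_subset hx hsW⟩ (Set.subset_insert x s) (Set.mem_insert x s))
    exact hs.insert (by rwa [Set.image_id])
  exact halg.extendScalars (FaithfulSMul.algebraMap_injective _ _)

variable {d : ℕ} {y : Fin d → E}

lemma IntermediateField.exists_aeval_mul_eq_aeval {ι : Type*} [Fintype ι] (f : ι → E)
    (hf : ∀ i, f i ∈ IntermediateField.adjoin K (Set.range y)) :
    ∃ g : MvPolynomial (Fin d) K, MvPolynomial.aeval y g ≠ 0 ∧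
      ∀ i, ∃ q : MvPolynomial (Fin d) K,
        MvPolynomial.aeval y g * f i = MvPolynomial.aeval y q := by
  classical
  have h : ∀ i, ∃ s : MvPolynomial (Fin d) K, MvPolynomial.aeval y s ≠ 0 ∧ ∃ q : MvPolynomial (Fin d) K,
      MvPolynomial.aeval y s * f i = MvPolynomial.aeval y q := by
    intro i
    obtain ⟨q, s, h⟩ := (IntermediateField.mem_adjoin_range_iff K y (f i)).1 (hf i)
    by_cases hs : MvPolynomial.aeval y s = 0
    · exact ⟨1, by simp, 0, by simp [h, hs]⟩
    · exact ⟨s, hs, q, by rw [h]; field_simp⟩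
  choose s hs q hq using h
  refine ⟨∏ i, s i, ?_, fun i => ⟨(∏ j ∈ Finset.univ.erase i, s j) * q i, ?_⟩⟩
  · rw [map_prod]
    exact Finset.prod_ne_zero_iff.2 fun i _ => hs i
  · rw [← Finset.prod_erase_mul _ _ (Finset.mem_univ i), map_mul, map_mul, mul_assoc, hq]

lemma IntermediateField.exists_sum_aeval_mul_eq_zero
    (E₁ : IntermediateField (IntermediateField.adjoin K (Set.range y)) E)
    [FiniteDimensional (IntermediateField.adjoin K (Set.range y)) E₁]
    (x : Fin (finrank (IntermediateField.adjoin K (Set.range y)) E₁ + 1) → E)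
    (hx : ∀ i, x i ∈ E₁) :
    ∃ g : Fin (finrank (IntermediateField.adjoin K (Set.range y)) E₁ + 1) →
      MvPolynomial (Fin d) K, g ≠ 0 ∧ ∑ i, MvPolynomial.aeval y (g i) * x i = 0 := by
  have hnot : ¬ LinearIndependent (IntermediateField.adjoin K (Set.range y))
      fun i => (⟨x i, hx i⟩ : E₁) := by
    intro h
    have := h.fintype_card_le_finrank
    simp at this
  obtain ⟨c, hc, i₀, hi₀⟩ := Fintype.not_linearIndependent_iff.1 hnot
  obtain ⟨g, hg, hq⟩ := IntermediateField.exists_aeval_mul_eq_aeval (K := K) (y := y)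
    (fun i => (c i : E)) fun i => (c i).2
  choose q hq using hq
  refine ⟨q, fun h => ?_, ?_⟩
  · have := hq i₀
    rw [h, Pi.zero_apply, map_zero, mul_eq_zero] at this
    exact hi₀ (Subtype.ext (this.resolve_left hg))
  · have hc' := congrArg (fun z : E₁ => (z : E)) hc
    simp only [IntermediateField.coe_sum, IntermediateField.coe_smul] at hc'
    simp only [← hq, mul_assoc, ← Finset.mul_sum]
    simp only [Algebra.smul_def] at hc'
    rw [mul_eq_zero]
    exact Or.inr hc'

end FiniteGeneration

section PolynomialGrowth

variable {K E : Type*} [Field K] [Field E] [Algebra K E] {d : ℕ} {y : Fin d → E}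

lemma Submodule.finrank_le_finrank_of_mul_mem {U G : Submodule K E} [FiniteDimensional K G] {z : E}
    (hz : z ≠ 0) (h : ∀ x ∈ U, z * x ∈ G) : finrank K U ≤ finrank K G := by
  let φ : U →ₗ[K] G := ((LinearMap.mulLeft K z).comp U.subtype).codRestrict G fun x => h x x.2
  refine LinearMap.finrank_le_finrank_of_injective (f := φ) fun a b hab => ?_
  have : z * (a : E) = z * (b : E) := congrArg (fun t : G => (t : E)) hab
  exact Subtype.ext (mul_left_cancel₀ hz this)

lemma IntermediateField.exists_finrank_pow_le
    (E₁ : IntermediateField (IntermediateField.adjoin K (Set.range y)) E)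
    [FiniteDimensional (IntermediateField.adjoin K (Set.range y)) E₁]
    (W : Submodule K E) [FiniteDimensional K W] (hW : ∀ x ∈ W, x ∈ E₁) :
    ∃ c r : ℕ, ∀ n : ℕ, finrank K ↥(W ^ n) ≤ r * (c * n + 1) ^ d := by
  classical
  have : Module.Free (IntermediateField.adjoin K (Set.range y)) E₁ :=
    Module.Free.of_divisionRing _ _
  set r := finrank (IntermediateField.adjoin K (Set.range y)) E₁
  let β := Module.finBasis (IntermediateField.adjoin K (Set.range y)) E₁
  let b := Module.finBasis K W
  have hr : 0 < r := finrank_pos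
  let f : Fin (finrank K W) × Fin r × Fin r → E := fun k =>
    (β.repr (⟨b k.1, hW _ (b k.1).2⟩ * β k.2.1) k.2.2 : E)
  have hf : ∀ i l, (b i : E) * β l = ∑ l', f (i, l, l') * β l' := by
    intro i l
    have := congrArg (fun z : E₁ => (z : E)) (β.sum_repr (⟨b i, hW _ (b i).2⟩ * β l))
    simp only [IntermediateField.coe_sum, Algebra.smul_def] at this
    exact this.symm
  obtain ⟨g, hg, hq⟩ := IntermediateField.exists_aeval_mul_eq_aeval (K := K) (y := y) f
    fun k => (β.repr (⟨b k.1, hW _ (b k.1).2⟩ * β k.2.1) k.2.2).2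
  choose q hq using hq
  let c : ℕ := ∑ k, (q k).totalDegree
  have hc : ∀ k, ∀ m ∈ (q k).support, ∀ i, m i ≤ c := fun k m hm i =>
    ((MvPolynomial.le_degreeOf_of_mem_support i hm).trans
      (MvPolynomial.degreeOf_le_totalDegree _ _)).trans
      (Finset.single_le_sum (f := fun k => (q k).totalDegree) (fun _ _ => Nat.zero_le _)
        (Finset.mem_univ k))
  let G : (n : ℕ) → Fin r × (Fin d → Fin (c * n + 1)) → E := fun n k =>
    (∏ i, y i ^ (k.2 i : ℕ)) * β k.1
  let P : ℕ → Submodule K E := fun n => Submodule.span K (Set.range (G n))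
  have hPfin : ∀ n, FiniteDimensional K (P n) := fun n =>
    FiniteDimensional.span_of_finite K (Set.finite_range _)
  have hPmem : ∀ n (a : Fin d → ℕ) l, (∀ i, a i ≤ c * n) → (∏ i, y i ^ a i) * β l ∈ P n :=
    fun n a l ha => Submodule.subset_span
      ⟨(l, fun i => ⟨a i, Nat.lt_succ_of_le (ha i)⟩), rfl⟩
  have hstep1 : ∀ n i v, v ∈ P n → MvPolynomial.aeval y g * b i * v ∈ P (n + 1) := by
    intro n i v hv
    induction hv using Submodule.span_induction with
    | mem v hv =>
      obtain ⟨⟨l, a⟩, rfl⟩ := hv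
      have : MvPolynomial.aeval y g * b i * G n (l, a) = ∑ l', MvPolynomial.aeval y (q (i, l, l')) *
          ((∏ i, y i ^ (a i : ℕ)) * β l') := by
        simp only [G]
        rw [show MvPolynomial.aeval y g * (b i : E) * ((∏ i, y i ^ (a i : ℕ)) * β l) =
          MvPolynomial.aeval y g * (∏ i, y i ^ (a i : ℕ)) * ((b i : E) * β l) by ring, hf,
          Finset.mul_sum]
        refine Finset.sum_congr rfl fun l' _ => ?_
        rw [← hq]; ring
      rw [this]
      refine Submodule.sum_mem _ fun l' _ => ?_
      rw [MvPolynomial.aeval_def, MvPolynomial.eval₂_eq', Finset.sum_mul]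
      refine Submodule.sum_mem _ fun m hm => ?_
      have hm' := hc (i, l, l') m hm
      rw [mul_assoc, ← Algebra.smul_def, ← mul_assoc, ← Finset.prod_mul_distrib]
      simp only [← pow_add]
      refine Submodule.smul_mem _ _ (hPmem _ (fun i => m i + a i) l' fun j => ?_)
      have h1 := hm' j
      have h2 := Nat.lt_succ_iff.1 (a j).2
      rw [mul_add, mul_one]
      omega
    | zero => simp
    | add v v' _ _ h h' => rw [mul_add]; exact add_mem h h'
    | smul t v _ h => rw [mul_smul_comm]; exact Submodule.smul_mem _ _ h
  have hstep : ∀ n, ∀ w ∈ W, ∀ v ∈ P n, MvPolynomial.aeval y g * w * v ∈ P (n + 1) := by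
    intro n w hw v hv
    have : w = ∑ i, b.repr ⟨w, hw⟩ i • (b i : E) := by
      have := congrArg W.subtype (b.sum_repr ⟨w, hw⟩)
      rw [_root_.map_sum] at this
      exact this.symm
    rw [this, Finset.mul_sum, Finset.sum_mul]
    refine Submodule.sum_mem _ fun i _ => ?_
    rw [mul_smul_comm, smul_mul_assoc]
    exact Submodule.smul_mem _ _ (hstep1 n i v hv)
  let e : E := β ⟨0, hr⟩
  have he : e ≠ 0 := fun h => β.ne_zero ⟨0, hr⟩ (Subtype.ext h)
  have hpow : ∀ n, ∀ x ∈ W ^ n, MvPolynomial.aeval y g ^ n * e * x ∈ P n := by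
    intro n
    induction n with
    | zero =>
      intro x hx
      rw [pow_zero, Submodule.mem_one] at hx
      obtain ⟨t, rfl⟩ := hx
      rw [pow_zero, one_mul, mul_comm, ← Algebra.smul_def]
      refine Submodule.smul_mem _ _ ?_
      have := hPmem 0 (fun _ => 0) ⟨0, hr⟩ (by simp)
      simpa using this
    | succ n ih =>
      intro x hx
      rw [pow_succ] at hx
      induction hx using Submodule.mul_induction_on' with
      | mem_mul_mem v hv w hw =>
        have := hstep n w hw _ (ih v hv)
        convert this using 1
        ring
      | add v _ v' _ h h' => rw [mul_add]; exact add_mem h h'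
  refine ⟨c, r, fun n => ?_⟩
  calc finrank K ↥(W ^ n) ≤ finrank K (P n) :=
        Submodule.finrank_le_finrank_of_mul_mem (mul_ne_zero (pow_ne_zero n hg) he) (hpow n)
    _ ≤ Fintype.card (Fin r × (Fin d → Fin (c * n + 1))) := finrank_range_le_card (G n)
    _ = r * (c * n + 1) ^ d := by simp

end PolynomialGrowth

section SubfieldOfRatios

lemma not_eventually_mul_le_add_of_le_polynomial (h : ℕ → ℕ) (c r d q : ℕ) {ρ : ℝ} (hρ : 1 < ρ)
    (h1 : ∀ n, 1 ≤ h n) (hle : ∀ n, h n ≤ r * (c * n + 1) ^ d)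
    (hgrow : ∀ᶠ n in atTop, ρ * h n ≤ h (n + q)) : False := by
  obtain ⟨n₁, hn₁⟩ := eventually_atTop.1 hgrow
  have hpow : ∀ k : ℕ, ρ ^ k ≤ h (n₁ + k * q) := by
    intro k
    induction k with
    | zero => simpa using h1 n₁
    | succ k ih =>
      calc ρ ^ (k + 1) = ρ * ρ ^ k := pow_succ' _ _
        _ ≤ ρ * h (n₁ + k * q) := by gcongr
        _ ≤ h (n₁ + k * q + q) := hn₁ _ (by omega)
        _ = h (n₁ + (k + 1) * q) := by congr 2; ring
  have hM : ∀ k : ℕ, 1 ≤ k → ρ ^ k ≤ (r * (c * n₁ + c * q + 1) ^ d : ℕ) * (k : ℝ) ^ d := by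
    intro k hk
    refine (hpow k).trans ?_
    calc (h (n₁ + k * q) : ℝ) ≤ ((r * (c * (n₁ + k * q) + 1) ^ d : ℕ) : ℝ) := by
          exact_mod_cast hle _
      _ ≤ ((r * ((c * n₁ + c * q + 1) * k) ^ d : ℕ) : ℝ) := by
          have : c * (n₁ + k * q) + 1 ≤ (c * n₁ + c * q + 1) * k := by nlinarith [Nat.zero_le (c * n₁)]
          exact_mod_cast Nat.mul_le_mul_left _ (Nat.pow_le_pow_left this _)
      _ = _ := by rw [mul_pow]; push_cast; ring
  have ht := (tendsto_pow_const_div_const_pow_of_one_lt d hρ).const_mul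
    ((r * (c * n₁ + c * q + 1) ^ d : ℕ) : ℝ)
  rw [mul_zero] at ht
  obtain ⟨k, hk, hk1⟩ := ((ht.eventually_lt_const one_pos).and (eventually_ge_atTop 1)).exists
  have hpos : 0 < ρ ^ k := by positivity
  rw [← mul_div_assoc, div_lt_one hpos] at hk
  exact absurd (hM k hk1) (not_le.2 hk)

variable {K E : Type*} [Field K] [Field E] [Algebra K E] {V : ℕ → Submodule K E}

lemma Submodule.pow_le_of_graded (h1 : (1 : E) ∈ V 0)
    (hmul : ∀ m n x z, x ∈ V m → z ∈ V n → x * z ∈ V (m + n)) (p n : ℕ) : V p ^ n ≤ V (n * p) := by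
  induction n with
  | zero => simpa [Submodule.one_le] using h1
  | succ n ih =>
    rw [pow_succ, Submodule.mul_le]
    intro x hx z hz
    have := hmul _ _ _ _ (ih hx) hz
    rwa [show (n + 1) * p = n * p + p by ring]

lemma Submodule.exists_algebraicIndependent_of_growth (hfin : ∀ n, FiniteDimensional K (V n))
    (h1 : (1 : E) ∈ V 0) (hmul : ∀ m n x z, x ∈ V m → z ∈ V n → x * z ∈ V (m + n))
    (hQ : ∀ n, ∃ J, ∀ s ≥ J, ∃ a ∈ V s, a ∈ V (s + n) ∧ a ≠ 0) (p : ℕ) (hp : 1 ≤ p)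
    (hVp : ∃ z ∈ V p, z ≠ 0) {ρ : ℝ} (hρ : 1 < ρ)
    (hgrow : ∀ᶠ n : ℕ in atTop, ρ * finrank K (V (n * p)) ≤ 2 * finrank K ↥(V p ^ n)) :
    ∃ (d : ℕ) (y : Fin d → E), AlgebraicIndependent K y ∧ (∀ i, y i ∈ V p) ∧
      (∃ r : ℕ, ∀ n (x : Fin (r + 1) → E), (∀ i, x i ∈ V n) →
        ∃ g : Fin (r + 1) → MvPolynomial (Fin d) K, g ≠ 0 ∧
          ∑ i, MvPolynomial.aeval y (g i) * x i = 0) ∧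
      ∃ C : ℝ, ∀ᶠ n : ℕ in atTop, (finrank K (V n) : ℝ) ≤ C * (n : ℝ) ^ d := by
  classical
  have := hfin p
  obtain ⟨d, y, hyi, hy, hintegral⟩ := (V p).exists_algebraicIndependent_fin
  let b := Module.finBasis K (V p)
  let S : Set E := Set.range fun i => (b i : E)
  let E₁ := IntermediateField.adjoin (IntermediateField.adjoin K (Set.range y)) S
  have hS : Finite S := Set.finite_range _
  have hE₁fin : FiniteDimensional (IntermediateField.adjoin K (Set.range y)) E₁ :=
    IntermediateField.finiteDimensional_adjoin (by rintro _ ⟨i, rfl⟩; exact hintegral _ (b i).2)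
  have hE₁smul : ∀ (t : K) (x : E), x ∈ E₁ → t • x ∈ E₁ := by
    intro t x hx
    rw [Algebra.smul_def]
    exact mul_mem (E₁.algebraMap_mem (algebraMap K (IntermediateField.adjoin K (Set.range y)) t)) hx
  have hVpE : ∀ x ∈ V p, x ∈ E₁ := by
    intro x hx
    have : x = ∑ i, b.repr ⟨x, hx⟩ i • (b i : E) := by
      have := congrArg (V p).subtype (b.sum_repr ⟨x, hx⟩)
      rw [_root_.map_sum] at this
      exact this.symm
    rw [this]
    exact sum_mem fun i _ => hE₁smul _ _ (IntermediateField.subset_adjoin _ S ⟨i, rfl⟩)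
  have hpowE : ∀ n, ∀ x ∈ V p ^ n, x ∈ E₁ := by
    intro n x hx
    induction hx using Submodule.pow_induction_on_left' with
    | algebraMap t => rw [Algebra.algebraMap_eq_smul_one]; exact hE₁smul _ _ (one_mem _)
    | add x z i _ _ h h' => exact add_mem h h'
    | mem_mul m hm i x _ h => exact mul_mem (hVpE m hm) h
  obtain ⟨c, r, hcr⟩ := IntermediateField.exists_finrank_pow_le E₁ (V p) hVpE
  obtain ⟨z₀, hz₀, hz₀0⟩ := hVp
  have hpowfin : ∀ n, FiniteDimensional K ↥(V p ^ n) := fun n => by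
    have := hfin (n * p)
    exact Submodule.finiteDimensional_of_le (Submodule.pow_le_of_graded h1 hmul p n)
  have hpos : ∀ n, 1 ≤ finrank K ↥(V p ^ n) := fun n => by
    have := hpowfin n
    have : Nontrivial ↥(V p ^ n) := ⟨⟨z₀ ^ n, Submodule.pow_mem_pow _ hz₀ _⟩, 0, fun h =>
      pow_ne_zero n hz₀0 (congrArg Subtype.val h)⟩
    exact finrank_pos
  have hmultE : ∀ q, ∀ x ∈ V (q * p), x ∈ E₁ := by
    intro q x hx
    by_contra hxE
    have hx0 : x ≠ 0 := fun h => hxE (h ▸ zero_mem _)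
    refine not_eventually_mul_le_add_of_le_polynomial _ c r d q hρ hpos hcr ?_
    filter_upwards [(tendsto_add_atTop_nat q).eventually hgrow] with n hn
    have h2 : 2 * finrank K ↥(V p ^ n) ≤ finrank K (V ((n + q) * p)) := by
      have := hpowfin n
      have := hfin ((n + q) * p)
      have hz0 : z₀ ^ q ≠ 0 := pow_ne_zero q hz₀0
      have hadd : (n + q) * p = q * p + n * p := by ring
      let A := (V p ^ n).map (LinearMap.mulLeft K (z₀ ^ q))
      let B := (V p ^ n).map (LinearMap.mulLeft K x)
      have hA : finrank K ↥(V p ^ n) ≤ finrank K A :=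
        Submodule.finrank_le_finrank_of_mul_mem hz0 fun v hv => ⟨v, hv, rfl⟩
      have hB : finrank K ↥(V p ^ n) ≤ finrank K B :=
        Submodule.finrank_le_finrank_of_mul_mem hx0 fun v hv => ⟨v, hv, rfl⟩
      have hAB : A ⊓ B = ⊥ := by
        rw [eq_bot_iff]
        rintro _ ⟨⟨v, hv, rfl⟩, ⟨v', hv', h⟩⟩
        simp only [LinearMap.mulLeft_apply] at h
        by_cases hv0 : v' = 0
        · simp only [hv0, mul_zero] at h
          simp [← h]
        · refine (hxE ?_).elim
          rw [eq_div_of_mul_eq hv0 h]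
          exact div_mem (mul_mem (hpowE q _ (Submodule.pow_mem_pow _ hz₀ _)) (hpowE n _ hv))
            (hpowE n _ hv')
      have hsup : A ⊔ B ≤ V ((n + q) * p) := by
        rw [hadd]
        refine sup_le ?_ ?_
        · rintro _ ⟨v, hv, rfl⟩
          exact hmul _ _ _ _ (Submodule.pow_le_of_graded h1 hmul p q
            (Submodule.pow_mem_pow _ hz₀ _)) (Submodule.pow_le_of_graded h1 hmul p n hv)
        · rintro _ ⟨v, hv, rfl⟩
          exact hmul _ _ _ _ hx (Submodule.pow_le_of_graded h1 hmul p n hv)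
      have hrank := Submodule.finrank_sup_add_finrank_inf_eq A B
      rw [hAB, finrank_bot, add_zero] at hrank
      have := Submodule.finrank_mono hsup
      omega
    have h2' : (2 : ℝ) * finrank K ↥(V p ^ n) ≤ finrank K (V ((n + q) * p)) := by exact_mod_cast h2
    nlinarith
  have hVE : ∀ m, ∀ x ∈ V m, x ∈ E₁ := by
    intro m x hx
    obtain ⟨J, hJ⟩ := hQ ((p - 1) * m)
    obtain ⟨a, ha, ha', ha0⟩ := hJ (J * p) (Nat.le_mul_of_pos_right _ hp)
    have h := hmul _ _ _ _ hx ha'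
    have hdeg : m + (J * p + (p - 1) * m) = (J + m) * p := by
      obtain ⟨p, rfl⟩ : ∃ p', p = p' + 1 := ⟨p - 1, by omega⟩
      simp only [Nat.add_sub_cancel]; ring
    rw [hdeg] at h
    have := div_mem (hmultE _ _ h) (hmultE _ _ ha)
    rwa [mul_div_cancel_right₀ _ ha0] at this
  refine ⟨d, y, hyi, hy, ⟨_, fun n x hx =>
    IntermediateField.exists_sum_aeval_mul_eq_zero E₁ x fun i => hVE n _ (hx i)⟩, ?_⟩
  obtain ⟨J, hJ⟩ := hQ 0
  obtain ⟨n₁, hn₁⟩ := eventually_atTop.1 hgrow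
  refine ⟨2 * (r * (c * (J + 2) + 1) ^ d : ℕ), ?_⟩
  filter_upwards [eventually_ge_atTop (n₁ * p + 1)] with m hm
  have hm1 : 1 ≤ m := by omega
  set n := m / p + J + 1 with hn
  have hmn : m + J ≤ n * p := by
    have h1 := Nat.div_add_mod m p
    have h2 := Nat.mod_lt m hp
    have h3 : J ≤ J * p := Nat.le_mul_of_pos_right _ hp
    have h4 : n * p = p * (m / p) + J * p + p := by rw [hn]; ring
    omega
  have hn1 : n₁ ≤ n := by
    have : n₁ ≤ m / p := (Nat.le_div_iff_mul_le hp).2 (by omega)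
    omega
  obtain ⟨a, ha, -, ha0⟩ := hJ (n * p - m) (by omega)
  have hle : finrank K (V m) ≤ finrank K (V (n * p)) := by
    have := hfin (n * p)
    refine Submodule.finrank_le_finrank_of_mul_mem ha0 fun x hx => ?_
    have := hmul _ _ _ _ ha hx
    rwa [Nat.sub_add_cancel (by omega)] at this
  have hnle : c * n + 1 ≤ (c * (J + 2) + 1) * m := by
    have h1 : n ≤ (J + 2) * m := by
      have : m / p ≤ m := Nat.div_le_self _ _
      nlinarith
    nlinarith [Nat.mul_le_mul_left c h1]
  have hfinal : finrank K ↥(V p ^ n) ≤ r * (c * (J + 2) + 1) ^ d * m ^ d := by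
    refine (hcr n).trans ?_
    rw [mul_assoc, ← mul_pow]
    exact Nat.mul_le_mul_left _ (Nat.pow_le_pow_left hnle _)
  have h3 : (finrank K ↥(V p ^ n) : ℝ) ≤ (r * (c * (J + 2) + 1) ^ d : ℕ) * (m : ℝ) ^ d := by
    exact_mod_cast hfinal
  have h4 : (finrank K (V m) : ℝ) ≤ finrank K (V (n * p)) := by exact_mod_cast hle
  have h5 := hn₁ n hn1
  have h6 : (0 : ℝ) ≤ finrank K (V (n * p)) := Nat.cast_nonneg _
  nlinarith

end SubfieldOfRatios

section FilteredGrowth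

variable {K E : Type*} [Field K] [Field E] [Algebra K E] {V : ℕ → Submodule K E}

lemma Fin.prod_ite_lt {M : Type*} [CommMonoid M] {n : ℕ} (a : Fin n) (x z : M) :
    ∏ s, (if s < a then x else z) = x ^ (a : ℕ) * z ^ (n - a) := by
  rw [Finset.prod_ite, Finset.prod_const, Finset.prod_const]
  congr 2
  · rw [← Fin.card_Iio]; congr 1; ext; simp
  · rw [← Fin.card_Ici]; congr 1; ext; simp

lemma prod_mem_of_quasiFiltered {A : Type*} [CommRing A] [Algebra K A] {Φ : ℕ → ℝ → Submodule K A}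
    {f : ℕ → ℝ} {n₀ : ℕ}
    (hqf : ∀ (l : ℕ), 2 ≤ l → ∀ (d : Fin l → ℕ) (t : Fin l → ℝ) (x : Fin l → A),
      (∀ i, n₀ ≤ d i) → (∀ i, x i ∈ Φ (d i) (t i)) →
      (∏ i, x i) ∈ Φ (∑ i, d i) (∑ i, (t i - f (d i))))
    {ι : Type*} [Fintype ι] (hι : 2 ≤ Fintype.card ι) (d : ι → ℕ) (t : ι → ℝ) (x : ι → A)
    (hd : ∀ i, n₀ ≤ d i) (hx : ∀ i, x i ∈ Φ (d i) (t i)) :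
    ∏ i, x i ∈ Φ (∑ i, d i) (∑ i, (t i - f (d i))) := by
  let φ := (Fintype.equivFin ι).symm
  have := hqf _ hι (fun i => d (φ i)) (fun i => t (φ i)) (fun i => x (φ i)) (fun i => hd _)
    fun i => hx _
  rwa [φ.prod_comp x, φ.sum_comp d, φ.sum_comp fun i => t i - f (d i)] at this

lemma exists_pow_mul_finrank_le_of_quasiFiltered (hfin : ∀ n, FiniteDimensional K (V n))
    (h1 : (1 : E) ∈ V 0) (hmul : ∀ m n x z, x ∈ V m → z ∈ V n → x * z ∈ V (m + n))
    (hQ : ∀ n, ∃ J, ∀ s ≥ J, ∃ a ∈ V s, a ∈ V (s + n) ∧ a ≠ 0) (p : ℕ) (hp : 1 ≤ p)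
    (hVp : ∃ z ∈ V p, z ≠ 0) {ρ : ℝ} (hρ : 1 < ρ)
    (hgrow : ∀ᶠ n : ℕ in atTop, ρ * finrank K (V (n * p)) ≤ 2 * finrank K ↥(V p ^ n))
    {Φ : ℕ → ℝ → Submodule K E} (hΦ : ∀ n t, Φ n t ≤ V n) (hΦtop : ∀ n, ∃ t, Φ n t = V n)
    {f : ℕ → ℝ} {n₀ : ℕ}
    (hqf : ∀ (l : ℕ), 2 ≤ l → ∀ (d : Fin l → ℕ) (t : Fin l → ℝ) (x : Fin l → E),
      (∀ i, n₀ ≤ d i) → (∀ i, x i ∈ Φ (d i) (t i)) →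
      (∏ i, x i) ∈ Φ (∑ i, d i) (∑ i, (t i - f (d i)))) :
    ∃ (d c J : ℕ) (C₁ : ℝ),
      (∃ C : ℝ, ∀ᶠ n : ℕ in atTop, (finrank K (V n) : ℝ) ≤ C * (n : ℝ) ^ d) ∧
      ∀ j ≥ J, ∃ C : ℝ, ∀ m ≥ n₀, ∀ (k : ℕ) (t : ℝ), k ^ d * finrank K (Φ m t) ≤
        finrank K (Φ (k * (m + c) + j) (k * (t - f m - C₁) - C)) := by
  obtain ⟨d, y, hyi, hy, ⟨r, hR⟩, C, hC⟩ :=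
    Submodule.exists_algebraicIndependent_of_growth hfin h1 hmul hQ p hp hVp hρ hgrow
  have hP : ∃ J, ∀ s ≥ J, ∃ e ∈ V s, e ≠ 0 := by
    obtain ⟨J, hJ⟩ := hQ 0
    exact ⟨J, fun s hs => let ⟨a, ha, _, ha0⟩ := hJ s hs; ⟨a, ha, ha0⟩⟩
  have hyr : ∀ i, ∃ n, ∃ x ∈ V n, ∃ z ∈ V n, z ≠ 0 ∧ y i * z = x := by
    intro i
    obtain ⟨J, hJ⟩ := hQ p
    obtain ⟨a, ha, ha', ha0⟩ := hJ J le_rfl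
    refine ⟨J + p, y i * a, ?_, a, ha', ha0, rfl⟩
    rw [add_comm]
    exact hmul _ _ _ _ (hy i) ha
  obtain ⟨d', hd', D, c, hc, X, X₀, u, hX, hX₀, hu, hcore⟩ :=
    hyi.exists_pow_mul_finrank_le hfin h1 hmul hP hyr r hR n₀
  obtain ⟨J, hJ⟩ := hP
  obtain ⟨τ, hτ⟩ := hΦtop c
  refine ⟨d', d' * c, c + J + n₀, -(d' * (τ - f c)), ⟨|C|, ?_⟩, fun j hj => ?_⟩
  · filter_upwards [hC, eventually_ge_atTop 1] with n hn hn1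
    have h1 : (1 : ℝ) ≤ n := by exact_mod_cast hn1
    calc (finrank K (V n) : ℝ) ≤ C * (n : ℝ) ^ d := hn
      _ ≤ |C| * (n : ℝ) ^ d := by gcongr; exact le_abs_self C
      _ ≤ |C| * (n : ℝ) ^ d' := by gcongr
  obtain ⟨e, he, he0⟩ := hJ (j - c) (by omega)
  obtain ⟨τ', hτ'⟩ := hΦtop (j - c)
  refine ⟨-(τ - f c) - (τ' - f (j - c)), fun m hm k t => ?_⟩
  have := hfin (k * (m + d' * c) + j)
  refine hcore m k (Φ m t) (hΦ _ _) _ (Submodule.finiteDimensional_of_le (hΦ _ _)) e he0 ?_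
  intro x hx a i
  let ι := Fin k ⊕ (Fin d' × Fin k) ⊕ Bool
  have h := prod_mem_of_quasiFiltered hqf (ι := ι) (by simp [ι]; omega)
    (Sum.elim (fun _ => m) (Sum.elim (fun _ => c) fun b => if b then c else j - c))
    (Sum.elim (fun _ => t) (Sum.elim (fun _ => τ) fun b => if b then τ else τ'))
    (Sum.elim (fun _ => x) (Sum.elim (fun q => if q.2 < a q.1 then X q.1 else X₀ q.1)
      fun b => if b then u i else e))
    (by
      rintro (s | q | b)
      · exact hm
      · exact hc
      · cases b
        · simp; omega
        · simpa using hc)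
    (by
      rintro (s | q | b)
      · exact hx
      · simp only [Sum.elim_inr, Sum.elim_inl, hτ]
        split_ifs
        · exact hX _
        · exact hX₀ _
      · cases b
        · simpa [hτ'] using he
        · simpa [hτ] using hu i)
  have hprod : x ^ k * (∏ i, (X i ^ (a i : ℕ) * X₀ i ^ (k - a i))) * u i * e =
      x ^ k * ((∏ i, (X i ^ (a i : ℕ) * X₀ i ^ (k - a i))) * (u i * e)) := by ring
  have hdeg : k * (m + d' * c) + j = k * m + (d' * k * c + (c + (j - c))) := by
    rw [Nat.add_sub_cancel' (by omega : c ≤ j)]; ring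
  have hlev : k * (t - f m - -(d' * (τ - f c))) - (-(τ - f c) - (τ' - f (j - c))) =
      k * (t - f m) + ((d' * k : ℕ) * (τ - f c) + (τ - f c + (τ' - f (j - c)))) := by
    push_cast; ring
  rw [hprod, hdeg, hlev]
  simp only [ι, Fintype.prod_sum_type, Fintype.sum_sum_type, Sum.elim_inl, Sum.elim_inr,
    Finset.prod_const, Finset.sum_const, Finset.card_univ, Fintype.card_fin, Fintype.card_prod,
    Fintype.prod_prod_type, Fintype.sum_bool, Fintype.prod_bool, smul_eq_mul,
    nsmul_eq_mul, Fin.prod_ite_lt, if_true, Bool.false_eq_true, if_false] at h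
  exact h

end FilteredGrowth

section GradedToField

variable {K A E : Type*} [Field K] [CommRing A] [Algebra K A] [Field E] [Algebra K E]
  [Algebra A E] [IsScalarTower K A E]

/-- Multiplication by the `n`-th power of `θ⁻¹`, from a domain to its field of fractions. -/
def dehomogenize (K : Type*) {A E : Type*} [Field K] [CommRing A] [Algebra K A] [Field E]
    [Algebra K E] [Algebra A E] [IsScalarTower K A E] (θ : E) (n : ℕ) : A →ₗ[K] E :=
  (LinearMap.mulRight K (θ⁻¹ ^ n)).comp (IsScalarTower.toAlgHom K A E).toLinearMap

lemma dehomogenize_apply (θ : E) (n : ℕ) (x : A) :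
    dehomogenize K θ n x = algebraMap A E x * θ⁻¹ ^ n := rfl

lemma dehomogenize_mul (θ : E) (m n : ℕ) (x z : A) :
    dehomogenize K θ m x * dehomogenize K θ n z = dehomogenize K θ (m + n) (x * z) := by
  simp only [dehomogenize_apply, map_mul, pow_add]; ring

lemma dehomogenize_prod (θ : E) {ι : Type*} (s : Finset ι) (n : ι → ℕ) (x : ι → A) :
    ∏ i ∈ s, dehomogenize K θ (n i) (x i) = dehomogenize K θ (∑ i ∈ s, n i) (∏ i ∈ s, x i) := by
  simp only [dehomogenize_apply, map_prod, Finset.prod_mul_distrib, Finset.prod_pow_eq_pow_sum]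

lemma dehomogenize_injective [FaithfulSMul A E] {θ : E} (hθ : θ ≠ 0) (n : ℕ) :
    Function.Injective (dehomogenize K (A := A) θ n) := fun _ _ h =>
  FaithfulSMul.algebraMap_injective A E
    (mul_right_cancel₀ (pow_ne_zero n (inv_ne_zero hθ)) h)

lemma map_dehomogenize_mul (θ : E) (m n : ℕ) (M N : Submodule K A) :
    M.map (dehomogenize K θ m) * N.map (dehomogenize K θ n) =
      (M * N).map (dehomogenize K θ (m + n)) := by
  apply le_antisymm
  · rw [Submodule.mul_le]
    rintro _ ⟨x, hx, rfl⟩ _ ⟨z, hz, rfl⟩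
    exact ⟨x * z, Submodule.mul_mem_mul hx hz, (dehomogenize_mul θ m n x z).symm⟩
  · rw [Submodule.map_le_iff_le_comap, Submodule.mul_le]
    intro x hx z hz
    rw [Submodule.mem_comap, ← dehomogenize_mul]
    exact Submodule.mul_mem_mul ⟨x, hx, rfl⟩ ⟨z, hz, rfl⟩

lemma map_dehomogenize_pow (θ : E) (p n : ℕ) (M : Submodule K A) :
    M.map (dehomogenize K θ p) ^ n = (M ^ n).map (dehomogenize K θ (n * p)) := by
  induction n with
  | zero =>
    ext x
    simp only [pow_zero, Submodule.mem_one, Submodule.mem_map, zero_mul]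
    constructor
    · rintro ⟨t, rfl⟩
      exact ⟨_, ⟨t, rfl⟩, by simp [dehomogenize_apply, ← IsScalarTower.algebraMap_apply]⟩
    · rintro ⟨_, ⟨t, rfl⟩, rfl⟩
      exact ⟨t, by simp [dehomogenize_apply, ← IsScalarTower.algebraMap_apply]⟩
  | succ n ih => rw [pow_succ, pow_succ, ih, map_dehomogenize_mul, add_mul, one_mul]

end GradedToField

lemma exists_pow_mul_finrank_le_of_approximable {K A : Type*} [Field K] [CommRing A] [IsDomain A]
    [Algebra K A] (𝒜 : ℕ → Submodule K A) [GradedAlgebra 𝒜]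
    (hfin : ∀ n, FiniteDimensional K ↥(𝒜 n))
    (hne : ∃ N : ℕ, ∀ n ≥ N, 𝒜 n ≠ ⊥)
    (happr : ∀ ε : ℝ, 0 < ε → ε < 1 → ∃ p₀ : ℕ, 1 ≤ p₀ ∧ ∀ p ≥ p₀,
      (1 - ε) < Filter.liminf
        (fun n : ℕ => (finrank K ↥((𝒜 p) ^ n) : ℝ) / (finrank K ↥(𝒜 (n * p)) : ℝ))
        Filter.atTop)
    (F : ℕ → ℝ → Submodule K A)
    (hFle : ∀ n t, F n t ≤ 𝒜 n)
    (hF_top : ∀ n, ∃ t₁ : ℝ, ∀ t ≤ t₁, F n t = 𝒜 n)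
    (f : ℕ → ℝ) (n₀ : ℕ)
    (hqf : ∀ (l : ℕ), 2 ≤ l → ∀ (d : Fin l → ℕ) (t : Fin l → ℝ) (x : Fin l → A),
      (∀ i, n₀ ≤ d i) → (∀ i, x i ∈ F (d i) (t i)) →
      (∏ i, x i) ∈ F (∑ i, d i) (∑ i, (t i - f (d i)))) :
    ∃ (d c J : ℕ) (C₁ : ℝ),
      (∃ C : ℝ, ∀ᶠ n : ℕ in atTop, (finrank K (𝒜 n) : ℝ) ≤ C * (n : ℝ) ^ d) ∧
      ∀ j ≥ J, ∃ C : ℝ, ∀ m ≥ n₀, ∀ (k : ℕ) (t : ℝ), k ^ d * finrank K (F m t) ≤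
        finrank K (F (k * (m + c) + j) (k * (t - f m - C₁) - C)) := by
  obtain ⟨N, hN⟩ := hne
  obtain ⟨u, hu, hu0⟩ := Submodule.exists_mem_ne_zero_of_ne_bot (hN (N + 1) (by omega))
  obtain ⟨u', hu', hu'0⟩ := Submodule.exists_mem_ne_zero_of_ne_bot (hN N le_rfl)
  let E := FractionRing A
  have hmap0 : ∀ {x : A}, x ≠ 0 → algebraMap A E x ≠ 0 := fun hx =>
    (map_ne_zero_iff _ (FaithfulSMul.algebraMap_injective A E)).2 hx
  let θ : E := algebraMap A E u / algebraMap A E u'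
  have hθ : θ ≠ 0 := div_ne_zero (hmap0 hu0) (hmap0 hu'0)
  have hinj : ∀ n, Function.Injective (dehomogenize K (A := A) θ n) := dehomogenize_injective hθ
  let V : ℕ → Submodule K E := fun n => (𝒜 n).map (dehomogenize K θ n)
  have hrank : ∀ n (M : Submodule K A), finrank K (M.map (dehomogenize K θ n)) = finrank K M :=
    fun n M => (Submodule.equivMapOfInjective _ (hinj n) M).finrank_eq.symm
  have hVfin : ∀ n, FiniteDimensional K (V n) := fun n => inferInstance
  have h1 : (1 : E) ∈ V 0 := ⟨1, SetLike.GradedOne.one_mem, by simp [dehomogenize_apply]⟩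
  have hmul : ∀ m n x z, x ∈ V m → z ∈ V n → x * z ∈ V (m + n) := by
    rintro m n _ _ ⟨x, hx, rfl⟩ ⟨z, hz, rfl⟩
    exact ⟨x * z, SetLike.GradedMul.mul_mem hx hz, (dehomogenize_mul θ m n x z).symm⟩
  have hV0 : ∀ n ≥ N, ∃ z ∈ V n, z ≠ 0 := by
    intro n hn
    obtain ⟨x, hx, hx0⟩ := Submodule.exists_mem_ne_zero_of_ne_bot (hN n hn)
    exact ⟨_, ⟨x, hx, rfl⟩, (map_ne_zero_iff _ (hinj n)).2 hx0⟩
  let a : E := dehomogenize K θ N u'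
  have ha0 : a ≠ 0 := (map_ne_zero_iff _ (hinj N)).2 hu'0
  have ha : a ∈ V N := ⟨u', hu', rfl⟩
  have ha' : a ∈ V (N + 1) := by
    refine ⟨u, hu, ?_⟩
    have hθu : algebraMap A E u * θ⁻¹ = algebraMap A E u' := by
      rw [inv_div, mul_div_cancel₀ _ (hmap0 hu0)]
    rw [dehomogenize_apply, pow_succ', ← mul_assoc, hθu]
    rfl
  have hQ : ∀ n, ∃ J, ∀ s ≥ J, ∃ a ∈ V s, a ∈ V (s + n) ∧ a ≠ 0 := by
    intro n
    refine ⟨n * N + N, fun s hs => ?_⟩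
    obtain ⟨z, hz, hz0⟩ := hV0 (s - n * N) (by omega)
    refine ⟨a ^ n * z, ?_, ?_, mul_ne_zero (pow_ne_zero n ha0) hz0⟩
    · have := hmul _ _ _ _ (Submodule.pow_mem_of_graded h1 hmul ha n) hz
      rwa [Nat.add_sub_cancel' (by omega)] at this
    · have := hmul _ _ _ _ (Submodule.pow_mem_of_graded h1 hmul ha' n) hz
      rwa [show n * (N + 1) + (s - n * N) = s + n by rw [mul_add, mul_one]; omega] at this
  obtain ⟨p₀, hp₀, hp⟩ := happr (1 / 4) (by norm_num) (by norm_num)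
  have hgrow : ∀ᶠ n : ℕ in atTop, (3 / 2 : ℝ) * finrank K (V (n * (p₀ + N))) ≤
      2 * finrank K ↥(V (p₀ + N) ^ n) := by
    have := eventually_lt_of_lt_liminf (hp (p₀ + N) (by omega))
      (isBoundedUnder_of ⟨0, fun n => by positivity⟩)
    filter_upwards [this] with n hn
    rw [map_dehomogenize_pow, hrank, hrank]
    have hpos : (0 : ℝ) < finrank K (𝒜 (n * (p₀ + N))) := by
      rcases (Nat.cast_nonneg (α := ℝ) (finrank K (𝒜 (n * (p₀ + N))))).lt_or_eq with h | h
      · exact h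
      · rw [← h, div_zero] at hn
        norm_num at hn
    rw [lt_div_iff₀ hpos] at hn
    linarith
  obtain ⟨d, c, J, C₁, ⟨C, hC⟩, h⟩ := exists_pow_mul_finrank_le_of_quasiFiltered hVfin h1 hmul hQ
    (p₀ + N) (by omega) (hV0 _ (by omega)) (by norm_num) hgrow
    (Φ := fun n t => (F n t).map (dehomogenize K θ n)) (f := f) (n₀ := n₀)
    (fun n t => Submodule.map_mono (hFle n t))
    (fun n => let ⟨t, ht⟩ := hF_top n; ⟨t, by simp only [V]; rw [ht t le_rfl]⟩)
    (by
      intro l hl d t x hd hx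
      choose x' hx' hxx using hx
      have := hqf l hl d t x' hd hx'
      refine ⟨_, this, ?_⟩
      rw [← dehomogenize_prod]
      exact Finset.prod_congr rfl fun i _ => hxx i)
  refine ⟨d, c, J, C₁, ⟨C, ?_⟩, fun j hj => ?_⟩
  · filter_upwards [hC] with n hn
    rwa [hrank] at hn
  · obtain ⟨C, hC⟩ := h j hj
    refine ⟨C, fun m hm k t => ?_⟩
    have := hC m hm k t
    rwa [hrank, hrank] at this

section RescaledLimit

variable {b : ℕ → ℝ} {φ : ℕ → ℝ → ℝ} {f : ℕ → ℝ} {d c J n₀ : ℕ} {C₁ : ℝ}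

lemma tendsto_nat_sub_div_div (J : ℕ) {q : ℕ} (hq : 0 < q) :
    Tendsto (fun n : ℕ => (((n - J) / q : ℕ) : ℝ) / n) atTop (nhds (1 / q)) := by
  have hq' : (0 : ℝ) < q := by exact_mod_cast hq
  have hlow : Tendsto (fun n : ℕ => 1 / (q : ℝ) - ((J + q : ℕ) / q : ℝ) * (1 / n)) atTop
      (nhds (1 / q)) := by
    simpa using (tendsto_one_div_atTop_nhds_zero_nat (𝕜 := ℝ)).const_mul ((J + q : ℕ) / q : ℝ)
      |>.const_sub (1 / (q : ℝ))
  refine tendsto_of_tendsto_of_tendsto_of_le_of_le' hlow tendsto_const_nhds ?_ ?_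
  · filter_upwards [eventually_gt_atTop 0] with n hn
    have hn' : (0 : ℝ) < n := by exact_mod_cast hn
    have h : n ≤ (n - J) / q * q + (J + q) := by
      have h1 := Nat.div_add_mod (n - J) q
      have h2 := Nat.mod_lt (n - J) hq
      rw [mul_comm] at h1
      omega
    have h' : (n : ℝ) ≤ ((n - J) / q : ℕ) * q + (J + q : ℕ) := by exact_mod_cast h
    rw [div_mul_div_comm, mul_one, div_sub_div _ _ hq'.ne' (by positivity), div_le_div_iff₀
      (by positivity) hn']
    nlinarith [mul_pos hn' hq', mul_pos (mul_pos hn' hq') hq', mul_pos hn' hn',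
      mul_le_mul_of_nonneg_right h' (mul_pos (mul_pos hn' hq') hq').le]
  · filter_upwards [eventually_gt_atTop 0] with n hn
    have hn' : (0 : ℝ) < n := by exact_mod_cast hn
    have h : (n - J) / q * q ≤ n := (Nat.div_mul_le_self _ _).trans (Nat.sub_le _ _)
    have h' : (((n - J) / q : ℕ) : ℝ) * q ≤ n := by exact_mod_cast h
    rw [div_le_div_iff₀ hn' hq']
    linarith

/-- Lower bounds for a rescaled filtration dimension propagate from one degree to all large
degrees. -/
lemma eventually_le_div_pow_of_pow_mul_le (hanti : ∀ n, Antitone (φ n))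
    (hkey : ∀ j ≥ J, ∃ C : ℝ, ∀ m ≥ n₀, ∀ (k : ℕ) (t : ℝ), (k : ℝ) ^ d * φ m t ≤
      φ (k * (m + c) + j) (k * (t - f m - C₁) - C)) {m : ℕ} (hm : n₀ ≤ m) (hm1 : 1 ≤ m) {t σ z : ℝ}
    (hσ : σ < (t - f m - C₁) / (m + c)) (hz : z < φ m t / (m + c) ^ d) :
    ∀ᶠ n : ℕ in atTop, z ≤ φ n (n * σ) / (n : ℝ) ^ d := by
  choose! C hC using hkey
  set q := m + c with hq
  have hq0 : 0 < q := by omega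
  have hqr : ((m : ℝ) + c) = q := by rw [hq]; push_cast; ring
  rw [hqr] at hσ hz
  let D := ∑ i ∈ Finset.range q, |C (J + i)|
  have hD : ∀ i < q, C (J + i) ≤ D := fun i hi => (le_abs_self _).trans
    (Finset.single_le_sum (f := fun i => |C (J + i)|) (fun _ _ => abs_nonneg _)
      (Finset.mem_range.2 hi))
  have hk := tendsto_nat_sub_div_div J hq0
  have hD0 := (tendsto_one_div_atTop_nhds_zero_nat (𝕜 := ℝ)).const_mul D
  have h1 := (hk.const_mul (t - f m - C₁)).sub hD0
  rw [mul_zero, sub_zero, mul_one_div] at h1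
  have h2 := (hk.pow d).mul_const (φ m t)
  rw [div_pow, one_pow, one_div_mul_eq_div] at h2
  filter_upwards [h1.eventually_const_lt hσ, h2.eventually_const_lt hz, eventually_ge_atTop J,
    eventually_gt_atTop 0] with n hn1 hn2 hnJ hn0
  have hn' : (0 : ℝ) < n := by exact_mod_cast hn0
  set k := (n - J) / q with hkdef
  have hnk : k * q + (J + (n - J) % q) = n := by
    have h1 : k * q + (n - J) % q = n - J := Nat.div_add_mod' (n - J) q
    omega
  have h := hC (J + (n - J) % q) (by omega) m hm k t
  rw [← hq, hnk] at h
  have hle : n * σ ≤ k * (t - f m - C₁) - C (J + (n - J) % q) := by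
    have h3 := hD _ (Nat.mod_lt (n - J) hq0)
    have h4 : (n : ℝ) * σ ≤ n * ((t - f m - C₁) * (k / n) - D * (1 / n)) := by gcongr
    have h5 : (n : ℝ) * ((t - f m - C₁) * (k / n) - D * (1 / n)) = k * (t - f m - C₁) - D := by
      field_simp
    linarith
  rw [le_div_iff₀ (by positivity)]
  calc z * (n : ℝ) ^ d ≤ (k / n) ^ d * φ m t * (n : ℝ) ^ d := by gcongr
    _ = (k : ℝ) ^ d * φ m t := by rw [div_pow]; field_simp
    _ ≤ _ := h
    _ ≤ _ := hanti n hle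

lemma tendsto_div_add_pow (c d : ℕ) :
    Tendsto (fun m : ℕ => ((m : ℝ) / (m + c)) ^ d) atTop (nhds 1) := by
  simpa using (tendsto_natCast_div_add_atTop (c : ℝ)).pow d

/-- The normalised dimensions converge to a positive limit. -/
lemma exists_tendsto_div_pow (hb0 : ∀ n, 0 ≤ b n) (hb : ∀ᶠ n in atTop, 0 < b n)
    (hbd : ∃ C : ℝ, ∀ᶠ n : ℕ in atTop, b n ≤ C * (n : ℝ) ^ d)
    (hkey : ∀ j ≥ J, ∀ m ≥ n₀, ∀ k : ℕ, (k : ℝ) ^ d * b m ≤ b (k * (m + c) + j)) :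
    ∃ L : ℝ, 0 < L ∧ Tendsto (fun n : ℕ => b n / (n : ℝ) ^ d) atTop (nhds L) := by
  obtain ⟨C, hC⟩ := hbd
  have hlow : ∀ m ≥ n₀, 1 ≤ m → ∀ z, z < b m / (m : ℝ) ^ d * ((m : ℝ) / (m + c)) ^ d →
      ∀ᶠ n : ℕ in atTop, z ≤ b n / (n : ℝ) ^ d := by
    intro m hm hm1 z hz
    have hm0 : (m : ℝ) ≠ 0 := by positivity
    rw [div_pow, div_mul_div_cancel₀ (pow_ne_zero d hm0)] at hz
    refine eventually_le_div_pow_of_pow_mul_le (φ := fun n _ => b n) (f := fun _ => 0) (C₁ := 0)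
      (t := 0) (σ := -1) (fun n _ _ _ => le_rfl) (fun j hj => ⟨0, fun m hm k _ => hkey j hj m hm k⟩)
      hm hm1 (by simp) hz
  have hC' : ∀ᶠ n : ℕ in atTop, b n / (n : ℝ) ^ d ≤ C := by
    filter_upwards [hC, eventually_gt_atTop 0] with n hn hn0
    rw [div_le_iff₀ (by positivity)]
    exact hn
  have hbdd : IsBoundedUnder (· ≤ ·) atTop fun n : ℕ => b n / (n : ℝ) ^ d := ⟨C, hC'⟩
  have hge : ∀ n : ℕ, 0 ≤ b n / (n : ℝ) ^ d := fun n => div_nonneg (hb0 n) (by positivity)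
  have hcobdd : IsCoboundedUnder (· ≤ ·) atTop fun n : ℕ => b n / (n : ℝ) ^ d :=
    (isBoundedUnder_of ⟨0, hge⟩ : IsBoundedUnder (· ≥ ·) atTop _).isCoboundedUnder_le
  set L := limsup (fun n : ℕ => b n / (n : ℝ) ^ d) atTop with hL
  have hlim : Tendsto (fun n : ℕ => b n / (n : ℝ) ^ d) atTop (nhds L) := by
    refine tendsto_order.2 ⟨fun y hy => ?_, fun y hy => eventually_lt_of_limsup_lt hy hbdd⟩
    obtain ⟨y', hy1, hy'⟩ := exists_between hy
    obtain ⟨y'', hy2, hy''⟩ := exists_between hy'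
    have hfreq := frequently_lt_of_lt_limsup hcobdd hy''
    have hs : Tendsto (fun m : ℕ => C * (1 - ((m : ℝ) / (m + c)) ^ d)) atTop (nhds 0) := by
      simpa using ((tendsto_div_add_pow c d).const_sub 1).const_mul C
    obtain ⟨m, hm, hmC, hms, hmn, hm1⟩ := (hfreq.and_eventually (hC'.and
      ((hs.eventually_lt_const (sub_pos.2 hy2)).and ((eventually_ge_atTop n₀).and
        (eventually_ge_atTop 1))))).exists
    have hs1 : ((m : ℝ) / (m + c)) ^ d ≤ 1 := pow_le_one₀ (by positivity)
      (div_le_one_of_le₀ (by simp) (by positivity))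
    filter_upwards [hlow m hmn hm1 y' (by nlinarith)] with n hn
    exact hy1.trans_le hn
  refine ⟨L, ?_, hlim⟩
  obtain ⟨m, hm, hmn, hm1⟩ := (hb.and ((eventually_ge_atTop n₀).and
    (eventually_ge_atTop 1))).exists
  have hm0 : (0 : ℝ) < m := by exact_mod_cast hm1
  have hpos : 0 < b m / (m : ℝ) ^ d * ((m : ℝ) / (m + c)) ^ d := by positivity
  exact (half_pos hpos).trans_le (ge_of_tendsto hlim (hlow m hmn hm1 _ (half_lt_self hpos)))

lemma rescaled_limit (hb0 : ∀ n, 0 ≤ b n) (hb : ∀ᶠ n in atTop, 0 < b n)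
    (hbd : ∃ C : ℝ, ∀ᶠ n : ℕ in atTop, b n ≤ C * (n : ℝ) ^ d)
    (hanti : ∀ n, Antitone (φ n)) (hle : ∀ n t, φ n t ≤ b n)
    (htop : ∀ n, ∃ t, φ n t = b n)
    (hflim : Tendsto (fun n : ℕ => f n / n) atTop (nhds 0))
    (hkey : ∀ j ≥ J, ∃ C : ℝ, ∀ m ≥ n₀, ∀ (k : ℕ) (t : ℝ), (k : ℝ) ^ d * φ m t ≤
      φ (k * (m + c) + j) (k * (t - f m - C₁) - C)) :
    (∀ σ τ, σ < τ → ∀ y y', y < y' → (∃ᶠ n : ℕ in atTop, y' < φ n (n * τ) / b n) →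
      ∀ᶠ n : ℕ in atTop, y ≤ φ n (n * σ) / b n) ∧
    ∀ y < 1, ∃ σ, ∀ᶠ n : ℕ in atTop, y ≤ φ n (n * σ) / b n := by
  obtain ⟨L, hL, hlim⟩ := exists_tendsto_div_pow hb0 hb hbd (c := c) (J := J) (n₀ := n₀) (by
    intro j hj m hm k
    obtain ⟨C, hC⟩ := hkey j hj
    obtain ⟨t, ht⟩ := htop m
    exact ht ▸ (hC m hm k t).trans (hle _ _))
  have hlimc : Tendsto (fun m : ℕ => b m / ((m : ℝ) + c) ^ d) atTop (nhds L) := by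
    have := hlim.mul (tendsto_div_add_pow c d)
    rw [mul_one] at this
    refine this.congr' ?_
    filter_upwards [eventually_gt_atTop 0] with m hm
    have hm0 : (m : ℝ) ≠ 0 := by positivity
    rw [div_pow, div_mul_div_cancel₀ (pow_ne_zero d hm0)]
  have hmain : ∀ m ≥ n₀, 1 ≤ m → ∀ t σ y z, σ < (t - f m - C₁) / (m + c) →
      z < φ m t / (m + c) ^ d → y < z / L → ∀ᶠ n : ℕ in atTop, y ≤ φ n (n * σ) / b n := by
    intro m hm hm1 t σ y z hσ hz hy
    have h1 := eventually_le_div_pow_of_pow_mul_le hanti hkey hm hm1 hσ hz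
    have h2 : Tendsto (fun n : ℕ => z / (b n / (n : ℝ) ^ d)) atTop (nhds (z / L)) :=
      tendsto_const_nhds.div hlim hL.ne'
    filter_upwards [h1, h2.eventually_const_lt hy, hb, eventually_gt_atTop 0] with n hn1 hn2 hbn hn0
    have hn' : (0 : ℝ) < (n : ℝ) ^ d := by positivity
    refine hn2.le.trans ?_
    rw [div_div_eq_mul_div]
    gcongr
    rwa [le_div_iff₀ hn'] at hn1
  refine ⟨fun σ τ hστ y y' hy hfreq => ?_, fun y hy => ?_⟩
  · have hτ : Tendsto (fun m : ℕ => ((m : ℝ) * τ - f m - C₁) / (m + c)) atTop (nhds τ) := by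
      have h1 := ((tendsto_const_nhds (x := τ)).sub hflim).sub
        ((tendsto_one_div_atTop_nhds_zero_nat (𝕜 := ℝ)).const_mul C₁)
      have h2 := h1.mul (tendsto_natCast_div_add_atTop (c : ℝ))
      simp only [sub_zero, mul_zero, mul_one] at h2
      refine h2.congr' ?_
      filter_upwards [eventually_gt_atTop 0] with m hm
      have hm0 : (m : ℝ) ≠ 0 := by positivity
      have hmc : (m : ℝ) + c ≠ 0 := by positivity
      field_simp
    have h3 : L * ((y + y') / 2) < y' * L := by nlinarith
    obtain ⟨m, hm, hm1, hm2, hm3, hm4, hm5⟩ := (hfreq.and_eventually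
      ((hτ.eventually_const_lt hστ).and (((hlimc.const_mul y').eventually_const_lt h3).and
        (hb.and ((eventually_ge_atTop n₀).and (eventually_ge_atTop 1)))))).exists
    refine hmain m hm4 hm5 (m * τ) σ y (L * ((y + y') / 2)) hm1 (hm2.trans_le ?_) ?_
    · rw [mul_div_assoc']
      gcongr
      exact ((lt_div_iff₀ hm3).1 hm).le
    · rw [mul_div_cancel_left₀ _ hL.ne']; linarith
  · have h3 : L * ((y + 1) / 2) < L := by nlinarith
    obtain ⟨m, hm1, hm2, hm3⟩ := ((hlimc.eventually_const_lt h3).and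
      ((eventually_ge_atTop n₀).and (eventually_ge_atTop 1))).exists
    obtain ⟨t, ht⟩ := htop m
    refine ⟨(t - f m - C₁) / (m + c) - 1, hmain m hm2 hm3 t _ y (L * ((y + 1) / 2))
      (sub_one_lt _) (by rwa [ht]) ?_⟩
    rw [mul_div_cancel_left₀ _ hL.ne']; linarith

end RescaledLimit

/-- A sequence of probability measures on the real line whose tail functions have asymptotically
monotone oscillation, and which does not lose mass at infinity, converges weakly. -/
lemma exists_tendsto_probabilityMeasure (P : ℕ → ProbabilityMeasure ℝ)
    (hosc : ∀ σ τ, σ < τ → ∀ y y', y < y' →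
      (∃ᶠ n in atTop, y' < (P n : Measure ℝ).real (Ici τ)) →
      ∀ᶠ n in atTop, y ≤ (P n : Measure ℝ).real (Ici σ))
    (hlow : ∀ y < 1, ∃ σ, ∀ᶠ n in atTop, y ≤ (P n : Measure ℝ).real (Ici σ))
    (hup : ∃ C, ∀ t > C, ∀ᶠ n in atTop, (P n : Measure ℝ).real (Ici t) = 0) :
    ∃ μ : ProbabilityMeasure ℝ, Tendsto P atTop (nhds μ) := by
  set g : ℕ → ℝ → ℝ := fun n σ => (P n : Measure ℝ).real (Ici σ) with hg
  have hg0 : ∀ n σ, 0 ≤ g n σ := fun n σ => measureReal_nonneg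
  have hg1 : ∀ n σ, g n σ ≤ 1 := fun n σ => measureReal_le_one
  have hga : ∀ n, Antitone (g n) := fun n σ τ h => measureReal_mono (Ici_subset_Ici.2 h)
  set H : ℝ → ℝ := fun σ => liminf (fun n => g n σ) atTop with hH
  have hbge : ∀ σ, IsBoundedUnder (· ≥ ·) atTop fun n => g n σ :=
    fun σ => isBoundedUnder_of ⟨0, fun n => hg0 n σ⟩
  have hble : ∀ σ, IsBoundedUnder (· ≤ ·) atTop fun n => g n σ :=
    fun σ => isBoundedUnder_of ⟨1, fun n => hg1 n σ⟩
  have hHle : ∀ σ y, (∀ᶠ n in atTop, y ≤ g n σ) → y ≤ H σ := fun σ y h =>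
    le_liminf_of_le (hble σ).isCoboundedUnder_ge h
  have hH1 : ∀ σ, H σ ≤ 1 := fun σ =>
    liminf_le_of_frequently_le (Frequently.of_forall fun n => hg1 n σ) (hbge σ)
  have hH0 : ∀ σ, 0 ≤ H σ := fun σ => hHle σ 0 (Eventually.of_forall fun n => hg0 n σ)
  have hHanti : Antitone H := fun σ τ h =>
    liminf_le_liminf (Eventually.of_forall fun n => hga n h) (hbge τ) (hble σ).isCoboundedUnder_ge
  have hconv : ∀ a, ContinuousAt H a → Tendsto (fun n => g n a) atTop (nhds (H a)) := by
    intro a ha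
    refine tendsto_order.2 ⟨fun y hy => eventually_lt_of_lt_liminf hy (hbge a), fun y hy => ?_⟩
    obtain ⟨y₁, hy₁, hy₁'⟩ := exists_between hy
    obtain ⟨y₂, hy₂, hy₂'⟩ := exists_between hy₁'
    obtain ⟨σ, hσ, hσa⟩ := (((ha.eventually_lt_const hy₁).filter_mono
      (nhdsWithin_le_nhds (s := Iio a))).and self_mem_nhdsWithin).exists
    by_contra hcon
    have hfreq : ∃ᶠ n in atTop, y₂ < g n a :=
      (not_eventually.1 hcon).mono fun n hn => hy₂'.trans_le (not_lt.1 hn)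
    exact (hHle σ y₁ (hosc σ a hσa y₁ y₂ hy₂ hfreq)).not_gt hσ
  have hGmono : Monotone fun σ => 1 - H σ := fun σ τ h => sub_le_sub_left (hHanti h) 1
  set G := hGmono.stieltjesFunction with hG
  have hGge : ∀ x, 1 - H x ≤ G x := fun x => hGmono.le_rightLim le_rfl
  have hGle : ∀ x z, x < z → G x ≤ 1 - H z := fun x z h => hGmono.rightLim_le h
  have hGbot : Tendsto G atBot (nhds 0) := by
    refine tendsto_order.2 ⟨fun y hy => Eventually.of_forall fun x =>
      hy.trans_le ((sub_nonneg.2 (hH1 x)).trans (hGge x)), fun y hy => ?_⟩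
    obtain ⟨σ, hσ⟩ := hlow (1 - y / 2) (by linarith)
    filter_upwards [eventually_lt_atBot σ] with x hx
    have h1 := hGle x σ hx
    have h2 := hHle σ _ hσ
    linarith
  have hGtop : Tendsto G atTop (nhds 1) := by
    obtain ⟨C, hC⟩ := hup
    refine tendsto_const_nhds.congr' ?_
    filter_upwards [eventually_gt_atTop C] with x hx
    have h1 := hGle x (x + 1) (lt_add_one x)
    have h2 := hGge x
    have h3 : H x = 0 := le_antisymm
      (liminf_le_of_frequently_le ((hC x hx).mono fun n hn => hn.le).frequently (hbge x)) (hH0 x)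
    linarith [hH0 (x + 1)]
  have hGc : ∀ a, ContinuousAt H a → G a = 1 - H a ∧ Function.leftLim G a = 1 - H a := by
    intro a ha
    have hc : Tendsto (fun x => 1 - H x) (nhds a) (nhds (1 - H a)) := ha.const_sub 1
    have h1 : G a ≤ 1 - H a := by
      refine ge_of_tendsto (hc.mono_left (nhdsWithin_le_nhds (s := Ioi a))) ?_
      filter_upwards [self_mem_nhdsWithin] with z hz using hGle a z hz
    refine ⟨h1.antisymm (hGge a), ((G.mono.leftLim_le le_rfl).trans h1).antisymm ?_⟩
    refine le_of_tendsto (hc.mono_left (nhdsWithin_le_nhds (s := Iio a))) ?_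
    filter_upwards [self_mem_nhdsWithin] with z hz using
      (hGge z).trans (G.mono.le_leftLim hz)
  have hprob : IsProbabilityMeasure G.measure := G.isProbabilityMeasure hGbot hGtop
  have hdense : Dense {x | ContinuousAt H x} := by
    have := hHanti.countable_not_continuousAt.dense_compl ℝ
    simpa [compl_ofPred] using this
  refine ⟨⟨G.measure, hprob⟩, IsPiSystem.tendsto_probabilityMeasure_of_tendsto_of_mem
    (isPiSystem_Ico_mem {x | ContinuousAt H x} {x | ContinuousAt H x}) ?_ ?_ ?_⟩
  · rintro s ⟨a, -, b, -, -, rfl⟩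
    exact measurableSet_Ico
  · intro u hu x hx
    obtain ⟨l, r, ⟨hl, hr⟩, hlr⟩ := mem_nhds_iff_exists_Ioo_subset.1 (hu.mem_nhds hx)
    obtain ⟨a, ha, hla, hax⟩ := hdense.exists_between hl
    obtain ⟨b, hb, hxb, hbr⟩ := hdense.exists_between hr
    exact ⟨Ico a b, ⟨a, ha, b, hb, hax.trans hxb, rfl⟩, Ico_mem_nhds hax hxb,
      fun z hz => hlr ⟨hla.trans_le hz.1, hz.2.trans hbr⟩⟩
  · rintro s ⟨a, ha, b, hb, hab, rfl⟩
    rw [← NNReal.tendsto_coe]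
    have h1 : ∀ n, ((P n (Ico a b) : NNReal) : ℝ) = g n a - g n b := by
      intro n
      have h2 : Ico a b = Ici a \ Ici b := by ext; simp
      rw [h2]
      exact measureReal_sdiff (Ici_subset_Ici.2 hab.le) measurableSet_Ici
    have h3 : (G.measure (Ico a b)).toReal = H a - H b := by
      rw [G.measure_Ico, (hGc a ha).2, (hGc b hb).2, ENNReal.toReal_ofReal] <;>
        linarith [hHanti hab.le]
    simp only [h1]
    change Tendsto _ _ (nhds (G.measure (Ico a b)).toReal)
    rw [h3]
    exact (hconv a ha).sub (hconv b hb)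

lemma exists_probabilityMeasure_tendsto_integral_map_div (ν : ℕ → Measure ℝ) (g : ℕ → ℝ → ℝ)
    (hν : ∀ᶠ n in atTop, IsProbabilityMeasure (ν n) ∧ ∀ t, (ν n (Ici t)).toReal = g n t)
    (hosc : ∀ σ τ, σ < τ → ∀ y y', y < y' → (∃ᶠ n : ℕ in atTop, y' < g n (n * τ)) →
      ∀ᶠ n : ℕ in atTop, y ≤ g n (n * σ))
    (hlow : ∀ y < 1, ∃ σ, ∀ᶠ n : ℕ in atTop, y ≤ g n (n * σ))
    (hup : ∃ C, ∀ t > C, ∀ᶠ n : ℕ in atTop, g n (n * t) = 0) :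
    ∃ μ : Measure ℝ, IsProbabilityMeasure μ ∧ ∀ h : ℝ → ℝ, Continuous h → HasCompactSupport h →
      Tendsto (fun n : ℕ => ∫ x, h x ∂(Measure.map (fun x : ℝ => x / n) (ν n))) atTop
        (nhds (∫ x, h x ∂μ)) := by
  obtain ⟨N, hN⟩ := eventually_atTop.1 (hν.and (eventually_gt_atTop 0))
  have hmeas : ∀ n : ℕ, Measurable fun x : ℝ => x / n := fun n => measurable_id.div_const _
  have hp : ∀ n, IsProbabilityMeasure (Measure.map (fun x : ℝ => x / (n + N : ℕ)) (ν (n + N))) :=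
    fun n =>
      have := (hN (n + N) (by omega)).1.1
      Measure.isProbabilityMeasure_map (hmeas _).aemeasurable
  let P : ℕ → ProbabilityMeasure ℝ := fun n => ⟨_, hp n⟩
  have hP : ∀ n σ, (P n : Measure ℝ).real (Ici σ) = g (n + N) ((n + N : ℕ) * σ) := by
    intro n σ
    obtain ⟨⟨-, h1⟩, h2⟩ := hN (n + N) (by omega)
    have h3 : (0 : ℝ) < (n + N : ℕ) := by exact_mod_cast h2
    rw [← h1]
    change (Measure.map (fun x : ℝ => x / (n + N : ℕ)) (ν (n + N)) (Ici σ)).toReal = _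
    rw [Measure.map_apply (hmeas _) measurableSet_Ici]
    congr 2
    ext x
    simp only [mem_preimage, mem_Ici]
    rw [le_div_iff₀ h3, mul_comm]
  have hev : ∀ {p : ℕ → Prop}, (∀ᶠ n in atTop, p n) → ∀ᶠ n in atTop, p (n + N) := fun h =>
    (tendsto_add_atTop_nat N).eventually h
  obtain ⟨μ, hμ⟩ := exists_tendsto_probabilityMeasure P
    (by
      intro σ τ hστ y y' hy hfreq
      simp only [hP] at hfreq ⊢
      exact hev (hosc σ τ hστ y y' hy ((tendsto_add_atTop_nat N).frequently hfreq)))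
    (fun y hy => (hlow y hy).imp fun σ hσ => by simpa only [hP] using hev hσ)
    (hup.imp fun C hC t ht => by simpa only [hP] using hev (hC t ht))
  refine ⟨μ, inferInstance, fun h hc hs => ?_⟩
  rw [← tendsto_add_atTop_iff_nat N]
  exact ProbabilityMeasure.tendsto_iff_forall_integral_tendsto.1 hμ
    (BoundedContinuousFunction.ofNormedAddCommGroup h hc _
      (hc.bounded_above_of_compact_support hs).choose_spec)

/-- Let `B = ⊕ₙ Bₙ` (graded pieces `𝒜 n` of a graded domain)
be an approximable integral graded `K`-algebra, equipped with ℝ-filtrations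
`F n` on each `B_n` making `B` an `f`-quasi-filtered algebra for a function
`f : ℕ → ℝ₊` with `f(n)/n → 0`, and suppose `sup_n λ_max(B_n)/n < ∞`.
Then the rescaled measures `T_{1/n} ν_{B_n}` associated to the filtrations
converge vaguely to a Borel probability measure on `ℝ`. -/
theorem stmt7 {K A : Type*} [Field K] [CommRing A] [IsDomain A] [Algebra K A]
    (𝒜 : ℕ → Submodule K A) [GradedAlgebra 𝒜]
    (hfin : ∀ n, FiniteDimensional K ↥(𝒜 n))
    (hne : ∃ N : ℕ, ∀ n ≥ N, 𝒜 n ≠ ⊥)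
    -- approximability
    (happr : ∀ ε : ℝ, 0 < ε → ε < 1 → ∃ p₀ : ℕ, 1 ≤ p₀ ∧ ∀ p ≥ p₀,
      (1 - ε) < Filter.liminf
        (fun n : ℕ => (finrank K ↥((𝒜 p) ^ n) : ℝ) / (finrank K ↥(𝒜 (n * p)) : ℝ))
        Filter.atTop)
    -- the ℝ-filtration on each graded piece
    (F : ℕ → ℝ → Submodule K A)
    (hFle : ∀ n t, F n t ≤ 𝒜 n)
    (hF_anti : ∀ n, Antitone (F n))
    (hF_bot : ∀ n, ∃ t₀ : ℝ, ∀ t ≥ t₀, F n t = ⊥)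
    (hF_top : ∀ n, ∃ t₁ : ℝ, ∀ t ≤ t₁, F n t = 𝒜 n)
    (hF_leftcont : ∀ n, ∀ t : ℝ, F n t = ⨅ (s : ℝ) (_ : s < t), F n s)
    -- the function f with f(n)/n → 0
    (f : ℕ → ℝ) (hf0 : ∀ n, 0 ≤ f n)
    (hflim : Filter.Tendsto (fun n : ℕ => f n / n) Filter.atTop (nhds 0))
    -- B is f-quasi-filtered
    (n₀ : ℕ)
    (hqf : ∀ (l : ℕ), 2 ≤ l → ∀ (d : Fin l → ℕ) (t : Fin l → ℝ) (x : Fin l → A),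
      (∀ i, n₀ ≤ d i) → (∀ i, x i ∈ F (d i) (t i)) →
      (∏ i, x i) ∈ F (∑ i, d i) (∑ i, (t i - f (d i))))
    -- sup_n λ_max(B_n)/n < +∞
    (hlmax : ∃ C : ℝ, ∀ n : ℕ, 1 ≤ n → ∀ t : ℝ, F n t ≠ ⊥ → t ≤ C * n)
    -- the measures associated to the filtered spaces (B_n, F n)
    (ν : ℕ → Measure ℝ)
    (hν : ∀ n : ℕ, 𝒜 n ≠ ⊥ → IsProbabilityMeasure (ν n) ∧
      ∀ t : ℝ, ((ν n) (Ici t)).toReal = (finrank K ↥(F n t) : ℝ) / finrank K ↥(𝒜 n)) :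
    ∃ μ : Measure ℝ, IsProbabilityMeasure μ ∧
      ∀ h : ℝ → ℝ, Continuous h → HasCompactSupport h →
        Filter.Tendsto
          (fun n : ℕ => ∫ x, h x ∂(Measure.map (fun x : ℝ => x / n) (ν n)))
          Filter.atTop (nhds (∫ x, h x ∂μ)) := by
  have hpos : ∀ᶠ n in atTop, 0 < finrank K ↥(𝒜 n) := by
    obtain ⟨N, hN⟩ := hne
    filter_upwards [eventually_ge_atTop N] with n hn
    have := hfin n
    have := Submodule.nontrivial_iff_ne_bot.2 (hN n hn)
    exact finrank_pos
  obtain ⟨d, c, J, C₁, hbd, hkey⟩ := exists_pow_mul_finrank_le_of_approximable 𝒜 hfin hne happr F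
    hFle hF_top f n₀ hqf
  have hφb : ∀ n t, finrank K ↥(F n t) ≤ finrank K ↥(𝒜 n) := fun n t =>
    have := hfin n
    Submodule.finrank_mono (hFle n t)
  obtain ⟨hosc, hlow⟩ := rescaled_limit (b := fun n => (finrank K ↥(𝒜 n) : ℝ))
    (φ := fun n t => (finrank K ↥(F n t) : ℝ)) (f := f) (d := d) (c := c) (J := J) (n₀ := n₀)
    (C₁ := C₁) (fun n => Nat.cast_nonneg _) (hpos.mono fun n hn => Nat.cast_pos.2 hn) hbd
    (fun n s t hst => by
      have : FiniteDimensional K ↥(F n s) :=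
        have := hfin n
        Submodule.finiteDimensional_of_le (hFle n s)
      exact Nat.cast_le.2 (Submodule.finrank_mono (hF_anti n hst)))
    (fun n t => Nat.cast_le.2 (hφb n t))
    (fun n => (hF_top n).imp fun t ht => by rw [ht t le_rfl]) hflim
    (fun j hj => (hkey j hj).imp fun C hC m hm k t => by exact_mod_cast hC m hm k t)
  obtain ⟨C, hC⟩ := hlmax
  refine exists_probabilityMeasure_tendsto_integral_map_div ν
    (fun n t => (finrank K ↥(F n t) : ℝ) / finrank K ↥(𝒜 n)) ?_ hosc hlow ⟨C, fun t ht => ?_⟩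
  · filter_upwards [hpos] with n hn
    refine hν n fun h => ?_
    rw [h, finrank_bot] at hn
    exact hn.false
  · filter_upwards [eventually_gt_atTop 0] with n hn
    have hn' : (0 : ℝ) < n := by exact_mod_cast hn
    have h : F n (n * t) = ⊥ := by
      by_contra h
      nlinarith [hC n hn _ h]
    rw [h, finrank_bot, Nat.cast_zero, zero_div]
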